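/- arXiv:0705.4132 — 3 statements merged into one kernel-verified Lean document; each statement's English description precedes it below -/
import Mathlib

section
/- Let X be a set, Y ⊆ X a countable subset, n ≥ 0, and x(1),…,x(n) ∈ X∖Y pairwise distinct; put W = {x(1),…,x(n)}, W(i) = W∖{x(i)}, G = R⁺_{W∪Y}, and I = Σ_{i=1}^{n} R⁺_{W(i)∪Y} (the additive subgroup of G generated by the R⁺_{W(i)∪Y}). Then the quotient group G/I is a free abelian group. -/
set_option synthInstance.maxHeartbeats 1000000
set_option maxHeartbeats 1000000

/-- A multivariate integer polynomial is primitive if it is not divisible by any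
integer `m > 1`. -/
def MvPrimitive {X : Type*} (q : MvPolynomial X ℤ) : Prop :=
  ∀ m : ℤ, 1 < m → ¬ (MvPolynomial.C m ∣ q)

/-- `ℚ(X)`, the field of fractions of `ℤ[X]`. -/
abbrev FracField (X : Type*) := FractionRing (MvPolynomial X ℤ)

/-- The set of elements `p / q` of `ℚ(X)` with `p, q ∈ ℤ[X]` polynomials in the
variables from `Z` and `q` primitive. -/
def Rset (X : Type*) (Z : Set X) : Set (FracField X) :=
  {x | ∃ p q : MvPolynomial X ℤ,
      p ∈ MvPolynomial.supported ℤ Z ∧ q ∈ MvPolynomial.supported ℤ Z ∧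
      MvPrimitive q ∧
      x = algebraMap (MvPolynomial X ℤ) (FracField X) p /
          algebraMap (MvPolynomial X ℤ) (FracField X) q}

/-- `R_Z` as a subring of `ℚ(X)`; since the set `Rset X Z` is closed under the ring
operations (by Gauss's lemma), this subring is exactly `Rset X Z`. -/
noncomputable def Rsub (X : Type*) (Z : Set X) : Subring (FracField X) :=
  Subring.closure (Rset X Z)

/-- `R⁺_Z`, the additive group of `R_Z`, as an additive subgroup of `ℚ(X)`;
since the set `Rset X Z` is closed under addition and negation (by Gauss's lemma),
this additive subgroup is exactly `Rset X Z`. -/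
noncomputable def Radd (X : Type*) (Z : Set X) : AddSubgroup (FracField X) :=
  AddSubgroup.closure (Rset X Z)

theorem PT_step {M : Type*} [AddCommGroup M] [Module.IsTorsionFree ℤ M]
    (N N' : Submodule ℤ M) (hN' : N'.FG)
    (hp : ∀ (m : ℤ) (g : M), m ≠ 0 → m • g ∈ N → g ∈ N) :
    ∃ C : Submodule ℤ M, C ≤ N' ∧ N' ≤ N ⊔ C ∧ (∀ c ∈ C, c ∈ N → c = 0) ∧ Module.Free ℤ C := by
  have htf : Module.IsTorsionFree ℤ (M ⧸ N) := by
    rw [Module.isTorsionFree_iff_smul_eq_zero]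
    intro m y hy
    obtain ⟨g, rfl⟩ := Submodule.Quotient.mk_surjective N y
    by_cases hm : m = 0
    · exact Or.inl hm
    · right
      rw [← Submodule.Quotient.mk_smul, Submodule.Quotient.mk_eq_zero] at hy
      rw [Submodule.Quotient.mk_eq_zero]
      exact hp m g hm hy
  have hfin : Module.Finite ℤ (N'.map N.mkQ) := Module.Finite.iff_fg.mpr (hN'.map _)
  have hfree : Module.Free ℤ (N'.map N.mkQ) := inferInstance
  let f := N.mkQ.submoduleMap N'
  have hf : Function.Surjective f := LinearMap.submoduleMap_surjective _ _
  obtain ⟨s, hs⟩ := Module.projective_lifting_property f LinearMap.id hf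
  have hs' : ∀ q, N.mkQ (s q : M) = q := fun q => by
    have := LinearMap.congr_fun hs q
    exact congrArg Subtype.val this
  have hle : (LinearMap.range (N'.subtype ∘ₗ s)) ≤ N' := by
    rintro _ ⟨q, rfl⟩
    exact (s q).2
  refine ⟨LinearMap.range (N'.subtype ∘ₗ s), hle, ?_, ?_, ?_⟩
  · intro g hg
    have h1 : N.mkQ g ∈ N'.map N.mkQ := Submodule.mem_map_of_mem hg
    have h2 : g - (s ⟨_, h1⟩ : M) ∈ N := by
      rw [← Submodule.Quotient.mk_eq_zero, ← Submodule.mkQ_apply, map_sub, hs', sub_self]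
    rw [← sub_add_cancel g (s ⟨_, h1⟩ : M)]
    exact Submodule.add_mem_sup h2 ⟨_, rfl⟩
  · rintro _ ⟨q, rfl⟩ hc
    have h0 : (q : M ⧸ N) = 0 := by
      rw [← hs' q, Submodule.mkQ_apply, Submodule.Quotient.mk_eq_zero]; exact hc
    have : q = 0 := Subtype.ext h0
    rw [this]; simp
  · have : Module.Finite ℤ (LinearMap.range (N'.subtype ∘ₗ s)) := inferInstance
    infer_instance

theorem PT_free {M : Type*} [AddCommGroup M] [Countable M] [Module.IsTorsionFree ℤ M]
    (h : ∀ S : Finset M, ∃ N : Submodule ℤ M, N.FG ∧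
      ∀ (m : ℤ) (g : M), m ≠ 0 → m • g ∈ Submodule.span ℤ (S : Set M) → g ∈ N) :
    Module.Free ℤ M := by
  classical
  obtain ⟨e, he⟩ := exists_surjective_nat M
  let S : ℕ → Finset M := fun k => (Finset.range k).image e
  let P : ℕ → Submodule ℤ M := fun k =>
    { carrier := {g | ∃ m : ℤ, m ≠ 0 ∧ m • g ∈ Submodule.span ℤ (S k : Set M)}
      zero_mem' := ⟨1, one_ne_zero, by simp⟩
      add_mem' := by
        rintro a b ⟨m, hm, ha⟩ ⟨l, hl, hb⟩
        refine ⟨m * l, mul_ne_zero hm hl, ?_⟩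
        rw [smul_add]
        refine add_mem ?_ ?_
        · rw [mul_comm, mul_smul]; exact Submodule.smul_mem _ _ ha
        · rw [mul_smul]; exact Submodule.smul_mem _ _ hb
      smul_mem' := by
        rintro c a ⟨m, hm, ha⟩
        refine ⟨m, hm, ?_⟩
        rw [smul_comm]; exact Submodule.smul_mem _ _ ha }
  have hPmem : ∀ k g, g ∈ P k ↔ ∃ m : ℤ, m ≠ 0 ∧ m • g ∈ Submodule.span ℤ (S k : Set M) :=
    fun k g => Iff.rfl
  have hPfg : ∀ k, (P k).FG := by
    intro k
    obtain ⟨N, hN, hN'⟩ := h (S k)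
    have hle : P k ≤ N := by
      rintro g ⟨m, hm, hg⟩
      exact hN' m g hm hg
    haveI : IsNoetherian ℤ N := isNoetherian_of_fg_of_noetherian N hN
    exact Submodule.FG.of_le hN hle
  have hPpure : ∀ k (m : ℤ) (g : M), m ≠ 0 → m • g ∈ P k → g ∈ P k := by
    rintro k m g hm ⟨l, hl, hg⟩
    exact ⟨l * m, mul_ne_zero hl hm, by rw [mul_smul]; exact hg⟩
  have hPmono : Monotone P := by
    rintro a b hab g ⟨m, hm, hg⟩
    refine ⟨m, hm, Submodule.span_mono ?_ hg⟩
    intro y hy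
    simp only [S, Finset.coe_image, Finset.coe_range] at hy ⊢
    exact Set.image_mono (Set.Iio_subset_Iio hab) hy
  have hP0 : P 0 = ⊥ := by
    rw [eq_bot_iff]
    rintro g ⟨m, hm, hg⟩
    simp [S, hm] at hg
    simpa using hg
  have hPe : ∀ k, e k ∈ P (k+1) := by
    intro k
    refine ⟨1, one_ne_zero, ?_⟩
    rw [one_smul]
    apply Submodule.subset_span
    simp only [S, Finset.coe_image, Finset.coe_range]
    exact ⟨k, by simp, rfl⟩
  choose C hC1 hC2 hC3 hC4 using fun k => PT_step (P k) (P (k+1)) (hPfg (k+1)) (hPpure k)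
  have htop : iSup C = ⊤ := by
    have hk : ∀ k, P k ≤ iSup C := by
      intro k
      induction k with
      | zero => rw [hP0]; exact bot_le
      | succ k ih => exact (hC2 k).trans (sup_le ih (le_iSup C k))
    rw [eq_top_iff]
    intro g _
    obtain ⟨k, rfl⟩ := he g
    exact hk _ (hPe k)
  have hind : iSupIndep C := by
    apply iSupIndep_of_dfinsupp_lsum_injective
    rw [← LinearMap.ker_eq_bot, LinearMap.ker_eq_bot']
    intro v hv
    by_contra hne
    have hsne : v.support.Nonempty := by
      rw [Finset.nonempty_iff_ne_empty]
      intro h0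
      exact hne (DFinsupp.support_eq_empty.mp h0)
    let k := v.support.max' hsne
    have hk : k ∈ v.support := Finset.max'_mem _ _
    have hsum : ∑ i ∈ v.support, (v i : M) = 0 := by
      rw [← hv, DFinsupp.lsum_apply_apply, DFinsupp.sumAddHom_apply, DFinsupp.sum]
      rfl
    rw [← Finset.add_sum_erase _ _ hk] at hsum
    have h1 : ∑ i ∈ v.support.erase k, (v i : M) ∈ P k := by
      refine sum_mem fun i hi => ?_
      have hik : i < k := Finset.lt_max'_of_mem_erase_max' _ hsne hi
      exact hPmono (Nat.succ_le_of_lt hik) (hC1 i (v i).2)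
    have h2 : (v k : M) ∈ P k := by
      rw [eq_neg_of_add_eq_zero_left hsum]; exact neg_mem h1
    have h3 := hC3 k _ (v k).2 h2
    exact (DFinsupp.mem_support_iff.mp hk) (Subtype.ext h3)
  have hintern := DirectSum.isInternal_submodule_of_iSupIndep_of_iSup_eq_top hind htop
  exact Module.Free.of_equiv (LinearEquiv.ofBijective (DirectSum.coeLinearMap C) hintern)

section partB
open MvPolynomial

theorem MvPrimitive.ne_zero' {X : Type*} {q : MvPolynomial X ℤ} (hq : MvPrimitive q) : q ≠ 0 := by
  rintro rfl
  exact hq 2 (by norm_num) (dvd_zero _)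

theorem MvPrimitive.not_prime_dvd {X : Type*} {q : MvPolynomial X ℤ} (hq : MvPrimitive q)
    {p : ℕ} (hp : p.Prime) : ¬ (C (p : ℤ) ∣ q) :=
  hq p (by exact_mod_cast hp.one_lt)

theorem mvPrimitive_of_prime {X : Type*} {q : MvPolynomial X ℤ}
    (h : ∀ p : ℕ, p.Prime → ¬ (C (p : ℤ) ∣ q)) : MvPrimitive q := by
  intro m hm hd
  obtain ⟨p, hp, hpm⟩ := Nat.exists_prime_and_dvd (n := m.natAbs) (by omega)
  exact h p hp ((map_dvd C (Int.natCast_dvd.mpr hpm)).trans hd)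

theorem primeC {X : Type*} {p : ℕ} (hp : p.Prime) :
    Prime (C (p : ℤ) : MvPolynomial X ℤ) :=
  (prime_C_iff _).mpr (Nat.prime_iff_prime_int.mp hp)

theorem mvPrimitive_one {X : Type*} : MvPrimitive (1 : MvPolynomial X ℤ) :=
  mvPrimitive_of_prime fun _ hp hd => (primeC hp).not_dvd_one hd

theorem MvPrimitive.mul {X : Type*} {q r : MvPolynomial X ℤ} (hq : MvPrimitive q)
    (hr : MvPrimitive r) : MvPrimitive (q * r) := by
  refine mvPrimitive_of_prime fun p hp hd => ?_
  rcases (primeC hp).dvd_or_dvd hd with h | h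
  · exact hq.not_prime_dvd hp h
  · exact hr.not_prime_dvd hp h

theorem mem_supported_of_C_mul {X : Type*} {Z : Set X} {c : ℤ} (hc : c ≠ 0)
    {q : MvPolynomial X ℤ} (h : C c * q ∈ supported ℤ Z) : q ∈ supported ℤ Z := by
  rw [mem_supported] at h ⊢
  have hs : (C c * q).support = q.support := by
    ext d
    rw [mem_support_iff, mem_support_iff, coeff_C_mul]
    simp [hc]
  intro i hi
  apply h
  rw [Finset.mem_coe, mem_vars_iff_mem_support] at hi ⊢
  rwa [hs]

theorem exists_primitive {X : Type*} (q : MvPolynomial X ℤ) (hq : q ≠ 0) :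
    ∃ (c : ℤ) (r : MvPolynomial X ℤ), c ≠ 0 ∧ MvPrimitive r ∧ q = C c * r := by
  obtain ⟨d, hd⟩ := MvPolynomial.ne_zero_iff.mp hq
  induction hn : (coeff d q).natAbs using Nat.strong_induction_on generalizing q with
  | _ n ih =>
    by_cases hp : MvPrimitive q
    · exact ⟨1, q, one_ne_zero, hp, by simp⟩
    · simp only [MvPrimitive, not_forall, not_not] at hp
      obtain ⟨m, hm, r, rfl⟩ := hp
      have hr : r ≠ 0 := right_ne_zero_of_mul hq
      rw [coeff_C_mul] at hd hn
      have hdr := right_ne_zero_of_mul hd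
      have hlt : (coeff d r).natAbs < n := by
        rw [← hn, Int.natAbs_mul]
        have h1 : 0 < (coeff d r).natAbs := Int.natAbs_pos.mpr hdr
        have h2 : 1 < m.natAbs := by omega
        nlinarith
      obtain ⟨c, s, hc, hs, hrs⟩ := ih _ hlt r hr hdr rfl
      exact ⟨m * c, s, mul_ne_zero (by omega) hc, hs, by rw [hrs, C_mul, mul_assoc]⟩

theorem C_dvd_of_primitive_mul {X : Type*} {q : MvPolynomial X ℤ} (hq : MvPrimitive q)
    (m : ℕ) (hm : m ≠ 0) : ∀ {P : MvPolynomial X ℤ}, C (m : ℤ) ∣ q * P → C (m : ℤ) ∣ P := by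
  induction m using induction_on_primes with
  | zero => exact absurd rfl hm
  | one => intro P _; simp
  | prime_mul p a hp ih =>
    intro P h
    have ha : a ≠ 0 := right_ne_zero_of_mul hm
    have h1 : C (p : ℤ) ∣ q * P := by
      refine Dvd.dvd.trans ?_ h
      push_cast
      rw [C_mul]; exact dvd_mul_right _ _
    rcases (primeC hp).dvd_or_dvd h1 with h2 | ⟨P', rfl⟩
    · exact absurd h2 (hq.not_prime_dvd hp)
    · push_cast at h ⊢
      rw [C_mul] at h ⊢
      have h3 : C (a : ℤ) ∣ q * P' := by
        rw [mul_left_comm] at h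
        exact (mul_dvd_mul_iff_left (primeC hp).ne_zero).mp h
      exact mul_dvd_mul_left _ (ih ha h3)

theorem C_dvd_of_primitive_mul' {X : Type*} {q : MvPolynomial X ℤ} (hq : MvPrimitive q)
    (m : ℤ) (hm : m ≠ 0) {P : MvPolynomial X ℤ} (h : C m ∣ q * P) : C m ∣ P := by
  rw [C_dvd_iff_dvd_coeff] at h ⊢
  intro i
  have := (C_dvd_iff_dvd_coeff _ _).mp
    (C_dvd_of_primitive_mul hq m.natAbs (by omega) (P := P) ?_) i
  · exact Int.natAbs_dvd.mp this
  · rw [C_dvd_iff_dvd_coeff]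
    intro j
    exact Int.natAbs_dvd.mpr (h j)

theorem algebraMap_frac_ne_zero {X : Type*} {q : MvPolynomial X ℤ} (hq : q ≠ 0) :
    algebraMap (MvPolynomial X ℤ) (FracField X) q ≠ 0 := by
  rw [Ne, IsFractionRing.to_map_eq_zero_iff]; exact hq

theorem Rset_add {X : Type*} {Z : Set X} {a b : FracField X} (ha : a ∈ Rset X Z)
    (hb : b ∈ Rset X Z) : a + b ∈ Rset X Z := by
  obtain ⟨p, q, hp, hq, hq', rfl⟩ := ha
  obtain ⟨r, s, hr, hs, hs', rfl⟩ := hb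
  refine ⟨p * s + q * r, q * s, add_mem (mul_mem hp hs) (mul_mem hq hr), mul_mem hq hs,
    hq'.mul hs', ?_⟩
  rw [div_add_div _ _ (algebraMap_frac_ne_zero hq'.ne_zero')
    (algebraMap_frac_ne_zero hs'.ne_zero')]
  simp

theorem Rset_poly {X : Type*} {Z : Set X} {p : MvPolynomial X ℤ} (hp : p ∈ supported ℤ Z) :
    algebraMap _ (FracField X) p ∈ Rset X Z :=
  ⟨p, 1, hp, one_mem _, mvPrimitive_one, by simp⟩

theorem Rset_neg {X : Type*} {Z : Set X} {a : FracField X} (ha : a ∈ Rset X Z) :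
    -a ∈ Rset X Z := by
  obtain ⟨p, q, hp, hq, hq', rfl⟩ := ha
  exact ⟨-p, q, neg_mem hp, hq, hq', by simp [neg_div]⟩

theorem mem_Radd {X : Type*} {Z : Set X} {a : FracField X} : a ∈ Radd X Z ↔ a ∈ Rset X Z := by
  constructor
  · intro h
    induction h using AddSubgroup.closure_induction with
    | mem x hx => exact hx
    | zero => simpa using Rset_poly (X := X) (Z := Z) (zero_mem (supported ℤ Z))
    | add x y _ _ hx hy => exact Rset_add hx hy
    | neg x _ hx => exact Rset_neg hx
  · exact fun h => AddSubgroup.subset_closure h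

theorem Rset_mono {X : Type*} {Z Z' : Set X} (h : Z ⊆ Z') : Rset X Z ⊆ Rset X Z' := by
  rintro _ ⟨p, q, hp, hq, hq', rfl⟩
  exact ⟨p, q, supported_mono h hp, supported_mono h hq, hq', rfl⟩

theorem Radd_mono {X : Type*} {Z Z' : Set X} (h : Z ⊆ Z') : Radd X Z ≤ Radd X Z' :=
  AddSubgroup.closure_mono (Rset_mono h)

theorem countable_Radd {X : Type*} {Z : Set X} (hZ : Z.Countable) : Countable (Radd X Z) := by
  have : Countable Z := hZ
  have h1 : Countable (supported ℤ Z) := by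
    have : Countable (MvPolynomial Z ℤ) := by
      rw [← Cardinal.mk_le_aleph0_iff]
      refine (MvPolynomial.cardinalMk_le_max_lift).trans ?_
      simp
    exact (supportedEquivMvPolynomial (R := ℤ) Z).toEquiv.countable_iff.mpr this
  have h2 : ((Radd X Z : AddSubgroup (FracField X)) : Set (FracField X)).Countable := by
    refine (Set.countable_range (fun a : supported ℤ Z × supported ℤ Z =>
      algebraMap _ (FracField X) (a.1 : MvPolynomial X ℤ) /
        algebraMap _ (FracField X) (a.2 : MvPolynomial X ℤ))).mono ?_
    intro a ha
    obtain ⟨p, q, hp, hq, hq', rfl⟩ := mem_Radd.mp ha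
    exact ⟨(⟨p, hp⟩, ⟨q, hq⟩), rfl⟩
  exact h2

/-- finite sums of fractions vanish after applying a ring hom defined on denominators -/
theorem frac_sum_eq_zero {A L ι : Type*} [CommRing A] [IsDomain A] [Field L] (φ : A →+* L)
    (s : Finset ι) (P Q : ι → A) (hQ : ∀ i ∈ s, φ (Q i) ≠ 0)
    (h : ∑ i ∈ s, algebraMap A (FractionRing A) (P i) / algebraMap A (FractionRing A) (Q i) = 0) :
    ∑ i ∈ s, φ (P i) / φ (Q i) = 0 := by
  classical
  have key : ∃ N D : A, φ D ≠ 0 ∧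
      ∑ i ∈ s, algebraMap A (FractionRing A) (P i) / algebraMap A (FractionRing A) (Q i)
        = algebraMap A (FractionRing A) N / algebraMap A (FractionRing A) D ∧
      ∑ i ∈ s, φ (P i) / φ (Q i) = φ N / φ D := by
    clear h
    induction s using Finset.induction_on with
    | empty => exact ⟨0, 1, by simp, by simp, by simp⟩
    | insert a s ha ih =>
      obtain ⟨N, D, hD, h1, h2⟩ := ih (fun i hi => hQ i (Finset.mem_insert_of_mem hi))
      have hQa := hQ a (Finset.mem_insert_self _ _)
      have hne : ∀ x : A, φ x ≠ 0 → algebraMap A (FractionRing A) x ≠ 0 := by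
        intro x hx h0
        rw [IsFractionRing.to_map_eq_zero_iff] at h0
        exact hx (by rw [h0, map_zero])
      refine ⟨P a * D + Q a * N, Q a * D, by simp [hQa, hD], ?_, ?_⟩
      · rw [Finset.sum_insert ha, h1, div_add_div _ _ (hne _ hQa) (hne _ hD)]; simp
      · rw [Finset.sum_insert ha, h2, div_add_div _ _ hQa hD]; simp
  obtain ⟨N, D, hD, h1, h2⟩ := key
  rw [h1, div_eq_zero_iff] at h
  rw [h2]
  rcases h with h | h
  · rw [IsFractionRing.to_map_eq_zero_iff] at h; simp [h]
  · rw [IsFractionRing.to_map_eq_zero_iff] at h; simp [h] at hD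

/-- pure closure of a finite set in `R` is inside a f.g. submodule -/
theorem pure_closure_fg {X : Type*} (S : Finset (FracField X)) (hS : ∀ s ∈ S, s ∈ Rset X Set.univ) :
    ∃ N : Submodule ℤ (FracField X), N.FG ∧ ∀ (m : ℤ) (g : FracField X), m ≠ 0 →
      g ∈ Rset X Set.univ → m • g ∈ Submodule.span ℤ (S : Set (FracField X)) → g ∈ N := by
  classical
  have key : ∃ (q : MvPolynomial X ℤ) (T : Finset (X →₀ ℕ)), MvPrimitive q ∧
      ∀ s ∈ S, ∃ P : MvPolynomial X ℤ, P.support ⊆ T ∧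
        s = algebraMap _ (FracField X) P / algebraMap _ (FracField X) q := by
    induction S using Finset.induction_on with
    | empty => exact ⟨1, ∅, mvPrimitive_one, by simp⟩
    | insert a S ha ih =>
      obtain ⟨q, T, hq, h⟩ := ih (fun s hs => hS s (Finset.mem_insert_of_mem hs))
      obtain ⟨P, r, -, -, hr, hPr⟩ := hS a (Finset.mem_insert_self _ _)
      choose! F hF1 hF2 using h
      refine ⟨q * r, (P * q).support ∪ S.biUnion (fun s => (F s * r).support), hq.mul hr, ?_⟩
      have hq0 := algebraMap_frac_ne_zero hq.ne_zero'
      have hr0 := algebraMap_frac_ne_zero hr.ne_zero'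
      intro s hs
      rcases Finset.mem_insert.mp hs with rfl | hs
      · refine ⟨P * q, Finset.subset_union_left, ?_⟩
        rw [hPr]; simp only [map_mul]; field_simp
      · refine ⟨F s * r, ?_, ?_⟩
        · exact (Finset.subset_biUnion_of_mem (fun s => (F s * r).support) hs).trans
            Finset.subset_union_right
        · rw [map_mul, map_mul, mul_div_mul_right _ _ hr0]; exact hF2 s hs
  obtain ⟨q, T, hq, hT⟩ := key
  have hq0 := algebraMap_frac_ne_zero hq.ne_zero'
  let ev : (FracField X) := (algebraMap _ (FracField X) q)⁻¹
  refine ⟨Submodule.span ℤ ((T.image (fun t => algebraMap _ (FracField X) (monomial t (1:ℤ)) /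
    algebraMap _ (FracField X) q) : Finset (FracField X)) : Set (FracField X)), ⟨_, rfl⟩, ?_⟩
  intro m g hm hg hmg
  have h1 : ∃ P : MvPolynomial X ℤ, P.support ⊆ T ∧
      m • g = algebraMap _ (FracField X) P / algebraMap _ (FracField X) q := by
    generalize m • g = y at hmg ⊢
    induction hmg using Submodule.span_induction with
    | mem x hx => exact hT x hx
    | zero => exact ⟨0, by simp, by simp⟩
    | add x y _ _ hx hy =>
      obtain ⟨P, hP, rfl⟩ := hx
      obtain ⟨Q, hQ, rfl⟩ := hy
      exact ⟨P + Q, support_add.trans (Finset.union_subset hP hQ), by rw [map_add, add_div]⟩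
    | smul c x _ hx =>
      obtain ⟨P, hP, rfl⟩ := hx
      exact ⟨c • P, support_smul.trans hP, by rw [map_zsmul, smul_div_assoc]⟩
  obtain ⟨P, hP, hPq⟩ := h1
  obtain ⟨P', q', -, -, hq', rfl⟩ := hg
  have hq0' := algebraMap_frac_ne_zero hq'.ne_zero'
  have hd : q' * P = C m * (P' * q) := by
    apply IsFractionRing.injective (MvPolynomial X ℤ) (FracField X)
    rw [zsmul_eq_mul] at hPq
    have hC : algebraMap (MvPolynomial X ℤ) (FracField X) (C m) = (m : FracField X) := by
      simp
    rw [map_mul, map_mul, map_mul, hC]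
    field_simp at hPq
    linear_combination -hPq
  obtain ⟨P1, rfl⟩ := C_dvd_of_primitive_mul' hq' m hm (Dvd.intro _ hd.symm)
  have hPs : P1.support ⊆ T := by
    refine Finset.Subset.trans ?_ hP
    intro d
    rw [mem_support_iff, mem_support_iff, coeff_C_mul]
    simp [hm]
  have hcC : (C m : MvPolynomial X ℤ) ≠ 0 := by simpa using hm
  have hd' : q' * P1 = P' * q := by
    apply mul_left_cancel₀ hcC
    rw [← hd]; ring
  have hg' : algebraMap _ (FracField X) P' / algebraMap _ (FracField X) q' =
      algebraMap _ (FracField X) P1 / algebraMap _ (FracField X) q := by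
    rw [div_eq_div_iff hq0' hq0, ← map_mul, ← map_mul, ← hd', mul_comm]
  rw [hg', P1.as_sum, map_sum, Finset.sum_div]
  refine sum_mem fun d hd => ?_
  have : monomial d (coeff d P1) = (coeff d P1) • monomial d (1:ℤ) := by
    rw [smul_monomial]; simp
  rw [this, map_zsmul, smul_div_assoc]
  apply Submodule.smul_mem
  apply Submodule.subset_span
  exact Finset.mem_coe.mpr (Finset.mem_image_of_mem _ (hPs hd))

end partB

section partC
open MvPolynomial

/-- Fraction field of `F_p[X]`. -/
abbrev FFp (p : ℕ) [Fact p.Prime] (X : Type*) := FractionRing (MvPolynomial X (ZMod p))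

/-- reduction mod `p` -/
noncomputable def psiHom (p : ℕ) [Fact p.Prime] (X : Type*) : MvPolynomial X ℤ →+* FFp p X :=
  (algebraMap (MvPolynomial X (ZMod p)) (FFp p X)).comp (map (Int.castRingHom (ZMod p)))

/-- polynomials into Laurent series -/
noncomputable def iotaHom (A : Type*) [CommRing A] [IsDomain A] :
    Polynomial A →+* LaurentSeries (FractionRing A) :=
  (HahnSeries.ofPowerSeries ℤ (FractionRing A)).comp
    ((Polynomial.coeToPowerSeries.ringHom).comp
      (Polynomial.mapRingHom (algebraMap A (FractionRing A))))

theorem iotaHom_injective (A : Type*) [CommRing A] [IsDomain A] :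
    Function.Injective (iotaHom A) := by
  unfold iotaHom
  simp only [RingHom.coe_comp]
  refine HahnSeries.ofPowerSeries_injective.comp (Function.Injective.comp ?_ ?_)
  · exact Polynomial.coe_injective _
  · exact Polynomial.map_injective _ (IsFractionRing.injective _ _)

theorem iotaHom_C (A : Type*) [CommRing A] [IsDomain A] (a : A) :
    iotaHom A (Polynomial.C a) = HahnSeries.C (algebraMap A (FractionRing A) a) := by
  simp [iotaHom]

theorem iotaHom_X (A : Type*) [CommRing A] [IsDomain A] :
    iotaHom A (Polynomial.X) = HahnSeries.single 1 1 := by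
  simp [iotaHom]

open Classical in
/-- single out the variable `j` -/
noncomputable def deltaHom (K : Type*) [CommRing K] {X : Type*} (j : X) :
    MvPolynomial X K →+* Polynomial (MvPolynomial X K) :=
  eval₂Hom (Polynomial.C.comp C) (fun i => if i = j then Polynomial.X else Polynomial.C (MvPolynomial.X i))

theorem deltaHom_injective (K : Type*) [CommRing K] {X : Type*} (j : X) :
    Function.Injective (deltaHom K j) := by
  have h : (Polynomial.evalRingHom (MvPolynomial.X j : MvPolynomial X K)).comp (deltaHom K j) =
      RingHom.id _ := by
    apply MvPolynomial.ringHom_ext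
    · intro r; simp [deltaHom]
    · intro i
      by_cases hi : i = j <;> simp [deltaHom, hi]
  intro a b hab
  have := congrArg (Polynomial.evalRingHom (MvPolynomial.X j : MvPolynomial X K)) hab
  rw [← RingHom.comp_apply, ← RingHom.comp_apply, h] at this
  exact this

/-- Laurent expansion in the variable `j`, mod `p` -/
noncomputable def phiHom (p : ℕ) [Fact p.Prime] {X : Type*} (j : X) :
    MvPolynomial X ℤ →+* LaurentSeries (FFp p X) :=
  (iotaHom (MvPolynomial X (ZMod p))).comp
    ((deltaHom (ZMod p) j).comp (map (Int.castRingHom (ZMod p))))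

theorem phiHom_eq_zero {p : ℕ} [Fact p.Prime] {X : Type*} (j : X) {P : MvPolynomial X ℤ} :
    phiHom p j P = 0 ↔ C (p : ℤ) ∣ P := by
  rw [C_dvd_iff_zmod]
  unfold phiHom
  rw [RingHom.comp_apply, RingHom.comp_apply,
    map_eq_zero_iff _ (iotaHom_injective _), map_eq_zero_iff _ (deltaHom_injective _ _)]

theorem psiHom_C (p : ℕ) [Fact p.Prime] {X : Type*} (c : ℤ) :
    psiHom p X (C c) = algebraMap (MvPolynomial X (ZMod p)) (FFp p X) (C (c : ZMod p)) := by
  unfold psiHom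
  rw [RingHom.comp_apply, map_C]; rfl

theorem psiHom_eq_zero {p : ℕ} [Fact p.Prime] {X : Type*} {P : MvPolynomial X ℤ} :
    psiHom p X P = 0 ↔ C (p : ℤ) ∣ P := by
  rw [C_dvd_iff_zmod]
  unfold psiHom
  rw [RingHom.comp_apply, IsFractionRing.to_map_eq_zero_iff]

theorem phiHom_X_self (p : ℕ) [Fact p.Prime] {X : Type*} (j : X) :
    phiHom p j (MvPolynomial.X j) = HahnSeries.single 1 1 := by
  simp [phiHom, deltaHom, iotaHom_X]

theorem phiHom_X_ne (p : ℕ) [Fact p.Prime] {X : Type*} {i j : X} (h : i ≠ j) :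
    phiHom p j (MvPolynomial.X i) = HahnSeries.C (psiHom p X (MvPolynomial.X i)) := by
  simp [phiHom, deltaHom, iotaHom_C, psiHom, h]

theorem phiHom_supported (p : ℕ) [Fact p.Prime] {X : Type*} {j : X} {Z : Set X} (hj : j ∉ Z)
    {P : MvPolynomial X ℤ} (hP : P ∈ supported ℤ Z) :
    phiHom p j P = HahnSeries.C (psiHom p X P) := by
  have := MvPolynomial.hom_congr_vars (f₁ := phiHom p j)
    (f₂ := (HahnSeries.C (Γ := ℤ) (R := FFp p X)).comp (psiHom p X)) (p₁ := P) (p₂ := P)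
    (RingHom.ext_int _ _) ?_ rfl
  · exact this
  · intro i hi _
    rw [mem_supported] at hP
    exact phiHom_X_ne p (fun h => hj (h ▸ hP hi))

/-- base change of Laurent series along a subfield -/
noncomputable def laurentMap {F : Type*} [Field F] (A : Subfield F) :
    LaurentSeries A →+* LaurentSeries F where
  toFun x := x.map A.subtype
  map_one' := HahnSeries.map_one A.subtype.toMonoidWithZeroHom
  map_mul' x y := HahnSeries.map_mul (A.subtype : A →ₙ+* F)
  map_zero' := by ext; simp
  map_add' x y := by ext; simp

theorem coeff_mem_of_range {F : Type*} [Field F] (A : Subfield F) {a b : LaurentSeries F}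
    (ha : a ∈ (laurentMap A).range) (hb : b ∈ (laurentMap A).range) (k : ℤ) :
    (a / b).coeff k ∈ A := by
  obtain ⟨x, rfl⟩ := ha
  obtain ⟨y, rfl⟩ := hb
  rw [← map_div₀]
  exact ((x / y).coeff k).2

theorem const_coeff_lift (p : ℕ) [Fact p.Prime] {X : Type*} (j : X) (Z Z' : Set X)
    (hZ : ∀ i ∈ Z, i ≠ j → i ∈ Z') {P Q : MvPolynomial X ℤ} (hP : P ∈ supported ℤ Z)
    (hQ : Q ∈ supported ℤ Z) :
    ∃ P' Q' : MvPolynomial X ℤ, P' ∈ supported ℤ Z' ∧ Q' ∈ supported ℤ Z' ∧ MvPrimitive Q' ∧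
      (phiHom p j P / phiHom p j Q).coeff 0 = psiHom p X P' / psiHom p X Q' := by
  let B : Subring (FFp p X) := (supported ℤ Z').toSubring.map (psiHom p X)
  let A : Subfield (FFp p X) := Subfield.closure (B : Set (FFp p X))
  have hr : ∀ P ∈ supported ℤ Z, phiHom p j P ∈ (laurentMap A).range := by
    intro P hP
    rw [supported_eq_adjoin_X] at hP
    induction hP using Algebra.adjoin_induction with
    | mem x hx =>
      obtain ⟨i, hi, rfl⟩ := hx
      by_cases hij : i = j
      · subst hij
        rw [phiHom_X_self]
        refine ⟨HahnSeries.single 1 1, ?_⟩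
        change (HahnSeries.single 1 1).map A.subtype = _
        exact (HahnSeries.map_single A.subtype.toMonoidWithZeroHom.toZeroHom).trans (by simp)
      · rw [phiHom_X_ne p hij]
        have hm : psiHom p X (MvPolynomial.X i) ∈ A := Subfield.subset_closure
          ⟨_, X_mem_supported.mpr (hZ i hi hij), rfl⟩
        refine ⟨HahnSeries.C ⟨_, hm⟩, ?_⟩
        change (HahnSeries.C _).map A.subtype = _
        rw [HahnSeries.map_C]; rfl
    | algebraMap r => simp
    | add x y _ _ hx hy => rw [map_add]; exact add_mem hx hy
    | mul x y _ _ hx hy => rw [map_mul]; exact mul_mem hx hy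
  have hmem := coeff_mem_of_range A (hr P hP) (hr Q hQ) 0
  rw [Subfield.mem_closure_iff] at hmem
  obtain ⟨y, hy, z, hz, hyz⟩ := hmem
  rw [Subring.closure_eq] at hy hz
  obtain ⟨a, ha, rfl⟩ := hy
  obtain ⟨b, hb, rfl⟩ := hz
  rw [← hyz]
  by_cases hb0 : psiHom p X b = 0
  · exact ⟨0, 1, zero_mem _, one_mem _, mvPrimitive_one, by simp [hb0]⟩
  · have hbne : b ≠ 0 := by rintro rfl; simp at hb0
    obtain ⟨c, r, hc, hr, rfl⟩ := exists_primitive b hbne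
    have hrs : r ∈ supported ℤ Z' := mem_supported_of_C_mul hc hb
    rw [map_mul] at hb0
    have hcp : psiHom p X (C c) ≠ 0 := left_ne_zero_of_mul hb0
    have hrp : psiHom p X r ≠ 0 := right_ne_zero_of_mul hb0
    have hcc : ((c : ℤ) : ZMod p) ≠ 0 := by
      intro h0
      apply hcp
      rw [psiHom_C, h0]; simp
    obtain ⟨d, hd⟩ := ZMod.intCast_surjective ((c : ZMod p)⁻¹)
    have hdc : psiHom p X (C d) * psiHom p X (C c) = 1 := by
      rw [← map_mul, ← C_mul, psiHom_C]
      rw [Int.cast_mul, hd, inv_mul_cancel₀ hcc]; simp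
    refine ⟨C d * a, r, mul_mem (Subalgebra.algebraMap_mem _ d) ha, hrs, hr, ?_⟩
    rw [map_mul, map_mul]
    field_simp
    linear_combination (-(psiHom p X a)) * hdc

theorem sum_mem_p (p : ℕ) [Fact p.Prime] {X ι : Type*} (Z : Set X) (s : Finset ι)
    (P Q : ι → MvPolynomial X ℤ) (hP : ∀ i ∈ s, P i ∈ supported ℤ Z)
    (hQ : ∀ i ∈ s, Q i ∈ supported ℤ Z) (hQ' : ∀ i ∈ s, MvPrimitive (Q i))
    (h : ∑ i ∈ s, psiHom p X (P i) / psiHom p X (Q i) = 0) :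
    ∃ u ∈ Radd X Z, ∑ i ∈ s, algebraMap _ (FracField X) (P i) / algebraMap _ (FracField X) (Q i)
      = (p : FracField X) * u := by
  classical
  have hmem : ∑ i ∈ s, algebraMap _ (FracField X) (P i) / algebraMap _ (FracField X) (Q i) ∈
      Radd X Z := sum_mem fun i hi => mem_Radd.mpr ⟨_, _, hP i hi, hQ i hi, hQ' i hi, rfl⟩
  obtain ⟨N, D, hN, hD, hD', hND⟩ := mem_Radd.mp hmem
  have hpp : p.Prime := Fact.out
  have hne : ∀ q : MvPolynomial X ℤ, MvPrimitive q → psiHom p X q ≠ 0 := fun q hq h0 =>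
    hq.not_prime_dvd hpp (psiHom_eq_zero.mp h0)
  let P' : Option ι → MvPolynomial X ℤ := fun o => o.elim (-N) P
  let Q' : Option ι → MvPolynomial X ℤ := fun o => o.elim D Q
  have hz := frac_sum_eq_zero (psiHom p X) s.insertNone P' Q' ?_ ?_
  · rw [Finset.sum_insertNone] at hz
    simp only [P', Q', Option.elim, h, add_zero, map_neg] at hz
    rw [div_eq_zero_iff, neg_eq_zero] at hz
    have hN0 := hz.resolve_right (hne D hD')
    obtain ⟨N', rfl⟩ := psiHom_eq_zero.mp hN0
    have hp0 : (p : ℤ) ≠ 0 := by exact_mod_cast hpp.ne_zero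
    refine ⟨algebraMap _ (FracField X) N' / algebraMap _ (FracField X) D,
      mem_Radd.mpr ⟨_, _, mem_supported_of_C_mul hp0 hN, hD, hD', rfl⟩, ?_⟩
    rw [hND, map_mul, mul_div_assoc]
    simp
  · intro o ho
    cases o with
    | none => exact hne D hD'
    | some i => exact hne _ (hQ' i (Finset.some_mem_insertNone.mp ho))
  · rw [Finset.sum_insertNone]
    simp only [P', Q', Option.elim, map_neg]
    rw [hND]; ring

theorem torsion_aux (p : ℕ) [Fact p.Prime] {X : Type*} (V : Set X) (W : Finset X)
    (hWV : ∀ i ∈ W, i ∈ V)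
    (g : X → FracField X) (f : FracField X) (hg : ∀ i ∈ W, g i ∈ Radd X (V \ {i}))
    (hf : f ∈ Radd X V) (h : ∑ i ∈ W, g i = (p : FracField X) * f) :
    f ∈ ⨆ i ∈ W, Radd X (V \ {i}) := by
  classical
  have hpp : p.Prime := Fact.out
  have hp0 : (p : FracField X) ≠ 0 := by exact_mod_cast hpp.ne_zero
  induction W using Finset.induction_on generalizing g f with
  | empty =>
    have : f = 0 := by
      simpa [hp0, hpp.ne_zero] using h.symm
    rw [this]; exact zero_mem _
  | insert j J hj ih =>
    have hne : ∀ q : MvPolynomial X ℤ, MvPrimitive q → phiHom p j q ≠ 0 := fun q hq h0 =>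
      hq.not_prime_dvd hpp ((phiHom_eq_zero j).mp h0)
    have hg' := fun i (hi : i ∈ insert j J) => mem_Radd.mp (hg i hi)
    simp only [Rset, Set.mem_ofPred_eq] at hg'
    choose! P Q hP hQ hQ' hPQ using hg'
    obtain ⟨N, D, hN, hD, hD', hND⟩ := mem_Radd.mp hf
    -- expand
    let P1 : Option X → MvPolynomial X ℤ := fun o => o.elim (-(C (p : ℤ) * N)) P
    let Q1 : Option X → MvPolynomial X ℤ := fun o => o.elim D Q
    have hz := frac_sum_eq_zero (phiHom p j) (insert j J).insertNone P1 Q1 ?_ ?_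
    rotate_left
    · intro o ho
      cases o with
      | none => exact hne D hD'
      | some i => exact hne _ (hQ' i (Finset.some_mem_insertNone.mp ho))
    · rw [Finset.sum_insertNone]
      simp only [P1, Q1, Option.elim, map_neg, map_mul]
      rw [← Finset.sum_congr rfl hPQ, h, hND]; simp; ring
    have hCp : phiHom p j (C (p : ℤ) * N) = 0 :=
      (phiHom_eq_zero j).mpr (dvd_mul_right _ _)
    rw [Finset.sum_insertNone, Finset.sum_insert hj] at hz
    simp only [P1, Q1, Option.elim, map_neg, hCp, neg_zero, zero_div, zero_add] at hz
    have hz0 := congrArg (fun v : LaurentSeries (FFp p X) => v.coeff 0) hz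
    simp only [HahnSeries.coeff_add, HahnSeries.coeff_sum, HahnSeries.coeff_zero] at hz0
    have hjm := Finset.mem_insert_self j J
    have hji : ∀ i ∈ J, i ≠ j := fun i hi h => hj (h ▸ hi)
    have hjJ : j ∉ V \ {j} := by simp
    rw [phiHom_supported p hjJ (hP j hjm), phiHom_supported p hjJ (hQ j hjm), ← map_div₀,
      HahnSeries.C_apply, HahnSeries.coeff_single_same] at hz0
    have hlift := fun i (hi : i ∈ J) => const_coeff_lift p j (V \ {i}) ((V \ {i}) \ {j})
      (fun k hk hkj => ⟨hk, hkj⟩) (hP i (Finset.mem_insert_of_mem hi))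
      (hQ i (Finset.mem_insert_of_mem hi))
    choose! P2 Q2 hP2 hQ2 hQ2' hPQ2 using hlift
    rw [Finset.sum_congr rfl hPQ2] at hz0
    have hu := sum_mem_p p (V \ {j}) (insert j J) (Function.update P2 j (P j))
      (Function.update Q2 j (Q j)) ?_ ?_ ?_ ?_
    rotate_left
    · intro i hi
      rcases Finset.mem_insert.mp hi with rfl | hi
      · simpa using hP _ hjm
      · rw [Function.update_of_ne (hji i hi)]
        have hsub : (V \ {i}) \ {j} ⊆ V \ {j} := fun k hk => ⟨hk.1.1, hk.2⟩
        exact supported_mono hsub (hP2 i hi)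
    · intro i hi
      rcases Finset.mem_insert.mp hi with rfl | hi
      · simpa using hQ _ hjm
      · rw [Function.update_of_ne (hji i hi)]
        have hsub : (V \ {i}) \ {j} ⊆ V \ {j} := fun k hk => ⟨hk.1.1, hk.2⟩
        exact supported_mono hsub (hQ2 i hi)
    · intro i hi
      rcases Finset.mem_insert.mp hi with rfl | hi
      · simpa using hQ' _ hjm
      · rw [Function.update_of_ne (hji i hi)]
        exact hQ2' i hi
    · rw [Finset.sum_insert hj, Function.update_self, Function.update_self, ← hz0]
      congr 1
      refine Finset.sum_congr rfl fun i hi => ?_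
      rw [Function.update_of_ne (hji i hi), Function.update_of_ne (hji i hi)]
    obtain ⟨u, hu, hus⟩ := hu
    rw [Finset.sum_insert hj, Function.update_self, Function.update_self, ← hPQ j hjm] at hus
    have hus' : g j + ∑ i ∈ J, algebraMap _ (FracField X) (P2 i) /
        algebraMap _ (FracField X) (Q2 i) = (p : FracField X) * u := by
      rw [← hus]
      congr 1
      refine Finset.sum_congr rfl fun i hi => ?_
      rw [Function.update_of_ne (hji i hi), Function.update_of_ne (hji i hi)]
    have hmono : (⨆ i ∈ J, Radd X (V \ {i})) ≤ ⨆ i ∈ insert j J, Radd X (V \ {i}) :=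
      biSup_mono fun i hi => Finset.mem_insert_of_mem hi
    have hufin : u ∈ ⨆ i ∈ insert j J, Radd X (V \ {i}) :=
      (le_biSup (fun i => Radd X (V \ {i})) hjm) hu
    have hfu : f - u ∈ ⨆ i ∈ J, Radd X (V \ {i}) := by
      refine ih (fun i hi => hWV i (Finset.mem_insert_of_mem hi))
        (fun i => g i - algebraMap _ (FracField X) (P2 i) / algebraMap _ (FracField X) (Q2 i))
        (f - u) ?_ (sub_mem hf (Radd_mono Set.sdiff_subset hu)) ?_
      · intro i hi
        refine sub_mem (hg i (Finset.mem_insert_of_mem hi)) (mem_Radd.mpr ?_)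
        exact ⟨_, _, supported_mono Set.sdiff_subset (hP2 i hi),
          supported_mono Set.sdiff_subset (hQ2 i hi), hQ2' i hi, rfl⟩
      · rw [Finset.sum_insert hj] at h
        rw [Finset.sum_sub_distrib, mul_sub, ← h, ← hus']; ring
    rw [← sub_add_cancel f u]
    exact add_mem (hmono hfu) hufin

end partC

section partD
open MvPolynomial

theorem mem_biSup_exists {K X : Type*} [AddCommGroup K] (H : X → AddSubgroup K) (W : Finset X)
    {f : K} (hf : f ∈ ⨆ i ∈ W, H i) : ∃ g : X → K, (∀ i ∈ W, g i ∈ H i) ∧ ∑ i ∈ W, g i = f := by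
  classical
  induction W using Finset.induction_on generalizing f with
  | empty =>
    have : f = 0 := by simpa using hf
    exact ⟨0, by simp, by simp [this]⟩
  | insert j J hj ih =>
    rw [Finset.iSup_insert, AddSubgroup.mem_sup] at hf
    obtain ⟨a, ha, b, hb, rfl⟩ := hf
    obtain ⟨g, hg, rfl⟩ := ih hb
    have hji : ∀ i ∈ J, i ≠ j := fun i hi h => hj (h ▸ hi)
    refine ⟨Function.update g j a, ?_, ?_⟩
    · intro i hi
      rcases Finset.mem_insert.mp hi with rfl | hi
      · simpa using ha
      · rw [Function.update_of_ne (hji i hi)]; exact hg i hi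
    · rw [Finset.sum_insert hj, Function.update_self]
      congr 1
      exact Finset.sum_congr rfl fun i hi => by rw [Function.update_of_ne (hji i hi)]

theorem torsion_nat {X : Type*} (V : Set X) (W : Finset X)
    (hWV : ∀ i ∈ W, i ∈ V) (m : ℕ) (hm : m ≠ 0) : ∀ f : FracField X,
    f ∈ Radd X V → (m : FracField X) * f ∈ (⨆ i ∈ W, Radd X (V \ {i})) →
    f ∈ ⨆ i ∈ W, Radd X (V \ {i}) := by
  induction m using induction_on_primes with
  | zero => exact absurd rfl hm
  | one => intro f _ h; simpa using h
  | prime_mul p a hp ih =>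
    intro f hf h
    have ha : a ≠ 0 := right_ne_zero_of_mul hm
    haveI : Fact p.Prime := ⟨hp⟩
    apply ih ha f hf
    push_cast at h
    rw [mul_assoc] at h
    obtain ⟨g, hg, hsum⟩ := mem_biSup_exists _ W h
    refine torsion_aux p V W hWV g _ hg ?_ hsum
    rw [← nsmul_eq_mul]
    exact nsmul_mem hf a

theorem torsion_int {X : Type*} (V : Set X) (W : Finset X)
    (hWV : ∀ i ∈ W, i ∈ V) (m : ℤ) (hm : m ≠ 0) (f : FracField X)
    (hf : f ∈ Radd X V) (h : (m : FracField X) * f ∈ (⨆ i ∈ W, Radd X (V \ {i}))) :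
    f ∈ ⨆ i ∈ W, Radd X (V \ {i}) := by
  refine torsion_nat V W hWV m.natAbs (by omega) f hf ?_
  rcases Int.natAbs_eq m with h1 | h1
  · rw [h1] at h; simpa using h
  · rw [h1] at h
    have := neg_mem h
    simpa using this

open Classical in
/-- copy of the variables in `S` -/
noncomputable def eMap {X : Type*} (S : Finset X) (z : X) : X ⊕ X :=
  if z ∈ S then Sum.inr z else Sum.inl z

theorem eMap_left {X : Type*} (S : Finset X) (P : MvPolynomial X ℤ) :
    aeval (Sum.elim MvPolynomial.X MvPolynomial.X : X ⊕ X → MvPolynomial X ℤ)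
      (rename (eMap S) P) = P := by
  rw [aeval_rename]
  have : (Sum.elim MvPolynomial.X MvPolynomial.X : X ⊕ X → MvPolynomial X ℤ) ∘ eMap S =
      MvPolynomial.X := by
    funext z
    by_cases hz : z ∈ S <;> simp [eMap, hz]
  rw [this, aeval_X_left_apply]

/-- substitution hom on fraction fields -/
noncomputable def sigmaPre {X : Type*} (S : Finset X) :
    MvPolynomial X ℤ →+* FracField (X ⊕ X) :=
  (algebraMap _ (FracField (X ⊕ X))).comp (rename (eMap S) : _ →ₐ[ℤ] _).toRingHom

theorem sigmaPre_injective {X : Type*} (S : Finset X) : Function.Injective (sigmaPre S) := by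
  unfold sigmaPre
  rw [RingHom.coe_comp]
  refine (IsFractionRing.injective _ _).comp ?_
  intro a b hab
  have := congrArg (aeval (Sum.elim MvPolynomial.X MvPolynomial.X : X ⊕ X → MvPolynomial X ℤ)) hab
  have h2 : aeval (Sum.elim MvPolynomial.X MvPolynomial.X : X ⊕ X → MvPolynomial X ℤ)
      (rename (eMap S) a) = aeval (Sum.elim MvPolynomial.X MvPolynomial.X) (rename (eMap S) b) :=
    this
  rwa [eMap_left, eMap_left] at h2

/-- substitution hom on fraction fields -/
noncomputable def sigmaHom {X : Type*} (S : Finset X) :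
    FracField X →+* FracField (X ⊕ X) :=
  IsFractionRing.lift (sigmaPre_injective S)

theorem sigmaHom_div {X : Type*} (S : Finset X) (P Q : MvPolynomial X ℤ) :
    sigmaHom S (algebraMap _ (FracField X) P / algebraMap _ (FracField X) Q) =
      algebraMap _ (FracField (X ⊕ X)) (rename (eMap S) P) /
      algebraMap _ (FracField (X ⊕ X)) (rename (eMap S) Q) := by
  rw [map_div₀, sigmaHom, IsFractionRing.lift_algebraMap, IsFractionRing.lift_algebraMap]
  rfl

/-- the alternating substitution -/
noncomputable def tauHom {X : Type*} (W : Finset X) : FracField X →+ FracField (X ⊕ X) :=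
  ∑ S ∈ W.powerset, ((-1 : ℤ) ^ S.card) • (sigmaHom S : FracField X →+* FracField (X ⊕ X)).toAddMonoidHom

theorem tauHom_apply {X : Type*} (W : Finset X) (f : FracField X) :
    tauHom W f = ∑ S ∈ W.powerset, ((-1 : ℤ) ^ S.card) • sigmaHom S f := by
  unfold tauHom
  rw [AddMonoidHom.finsetSum_apply]
  rfl

theorem tauHom_mem {X : Type*} (V : Set X) (W : Finset X) {f : FracField X} (hf : f ∈ Radd X V) :
    tauHom W f ∈ Radd (X ⊕ X) Set.univ := by
  rw [tauHom_apply]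
  refine sum_mem fun S _ => zsmul_mem ?_ _
  obtain ⟨P, Q, hP, hQ, hQ', rfl⟩ := mem_Radd.mp hf
  rw [sigmaHom_div]
  refine mem_Radd.mpr ⟨_, _, by simp, by simp, ?_, rfl⟩
  intro m hm hd
  apply hQ' m hm
  have := map_dvd (aeval (Sum.elim MvPolynomial.X MvPolynomial.X : X ⊕ X → MvPolynomial X ℤ)) hd
  rw [eMap_left] at this
  rwa [← algebraMap_eq, AlgHom.commutes] at this

theorem rename_insert {X : Type*} [DecidableEq X] (V : Set X) (w : X) (S : Finset X)
    {P : MvPolynomial X ℤ} (hP : P ∈ supported ℤ (V \ {w})) :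
    rename (eMap (insert w S)) P = rename (eMap S) P := by
  have := MvPolynomial.hom_congr_vars
    (f₁ := (rename (eMap (insert w S)) : MvPolynomial X ℤ →ₐ[ℤ] MvPolynomial (X ⊕ X) ℤ).toRingHom)
    (f₂ := (rename (eMap S) : MvPolynomial X ℤ →ₐ[ℤ] MvPolynomial (X ⊕ X) ℤ).toRingHom) (p₁ := P) (p₂ := P)
    (RingHom.ext_int _ _) ?_ rfl
  · exact this
  · intro i hi _
    rw [mem_supported] at hP
    have hiw : i ≠ w := (hP hi).2
    change rename _ (MvPolynomial.X i) = rename _ (MvPolynomial.X i)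
    simp [eMap, hiw]

theorem tauHom_zero {X : Type*} (V : Set X) (W : Finset X) {w : X} (hw : w ∈ W)
    {f : FracField X} (hf : f ∈ Radd X (V \ {w})) : tauHom W f = 0 := by
  classical
  obtain ⟨P, Q, hP, hQ, hQ', rfl⟩ := mem_Radd.mp hf
  rw [tauHom_apply, ← Finset.insert_erase hw, Finset.sum_powerset_insert (Finset.notMem_erase _ _),
    ← Finset.sum_add_distrib]
  refine Finset.sum_eq_zero fun S hS => ?_
  have hwS : w ∉ S := fun h => Finset.notMem_erase w W (Finset.mem_powerset.mp hS h)
  rw [sigmaHom_div, sigmaHom_div, rename_insert V w S hP, rename_insert V w S hQ,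
    Finset.card_insert_of_notMem hwS, pow_succ, mul_neg_one, neg_smul, add_neg_cancel]

theorem exists_common {K ι : Type*} [CommRing K] (I : AddSubgroup K) (s : Finset ι) (T : ι → K)
    (h : ∀ i ∈ s, ∃ c : ℤ, c ≠ 0 ∧ (c : K) * T i ∈ I) :
    ∃ c : ℤ, c ≠ 0 ∧ (c : K) * ∑ i ∈ s, T i ∈ I := by
  classical
  induction s using Finset.induction_on with
  | empty => exact ⟨1, one_ne_zero, by simp⟩
  | insert a s ha ih =>
    obtain ⟨c, hc, h1⟩ := ih fun i hi => h i (Finset.mem_insert_of_mem hi)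
    obtain ⟨d, hd, h2⟩ := h a (Finset.mem_insert_self _ _)
    refine ⟨c * d, mul_ne_zero hc hd, ?_⟩
    rw [Finset.sum_insert ha, mul_add]
    refine add_mem ?_ ?_
    · have := zsmul_mem h2 c
      rw [zsmul_eq_mul] at this
      push_cast; rwa [mul_assoc]
    · have := zsmul_mem h1 d
      rw [zsmul_eq_mul] at this
      push_cast; rwa [mul_comm (c : K), mul_assoc]

/-- evaluate the copies at integers -/
noncomputable def epsHom {X : Type*} (b : X → ℤ) : MvPolynomial (X ⊕ X) ℤ →ₐ[ℤ] MvPolynomial X ℤ :=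
  aeval (Sum.elim MvPolynomial.X (fun z => C (b z)))

theorem eval_epsHom {X : Type*} (b : X → ℤ) (S : Finset X) (P : MvPolynomial X ℤ) :
    eval b (epsHom b (rename (eMap S) P)) = eval b P := by
  have : ((aeval b : MvPolynomial X ℤ →ₐ[ℤ] ℤ).comp ((epsHom b).comp (rename (eMap S)))) =
      (aeval b : MvPolynomial X ℤ →ₐ[ℤ] ℤ) := by
    apply MvPolynomial.algHom_ext
    intro z
    by_cases hz : z ∈ S <;> simp [epsHom, eMap, hz]
  have := AlgHom.congr_fun this P
  simpa [aeval_eq_eval] using this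

theorem epsHom_supported {X : Type*} (b : X → ℤ) (V : Set X) {S : Finset X} {w : X} (hw : w ∈ S)
    {P : MvPolynomial X ℤ} (hP : P ∈ supported ℤ V) :
    epsHom b (rename (eMap S) P) ∈ supported ℤ (V \ {w}) := by
  rw [supported_eq_adjoin_X] at hP
  induction hP using Algebra.adjoin_induction with
  | mem x hx =>
    obtain ⟨z, hz, rfl⟩ := hx
    by_cases hzS : z ∈ S
    · have : epsHom b (rename (eMap S) (MvPolynomial.X z)) = algebraMap ℤ _ (b z) := by
        simp [epsHom, eMap, hzS]
      rw [this]; exact Subalgebra.algebraMap_mem _ _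
    · have : epsHom b (rename (eMap S) (MvPolynomial.X z)) = MvPolynomial.X z := by
        simp [epsHom, eMap, hzS]
      rw [this, X_mem_supported]
      exact ⟨hz, fun h => hzS (by rw [Set.mem_singleton_iff.mp h]; exact hw)⟩
  | algebraMap r =>
    rw [AlgHom.commutes, AlgHom.commutes]; exact Subalgebra.algebraMap_mem _ _
  | add x y _ _ hx hy => rw [map_add, map_add]; exact add_mem hx hy
  | mul x y _ _ hx hy => rw [map_mul, map_mul]; exact mul_mem hx hy

theorem epsHom_empty {X : Type*} (b : X → ℤ) (P : MvPolynomial X ℤ) :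
    epsHom b (rename (eMap ∅) P) = P := by
  have : ((epsHom b).comp (rename (eMap ∅))) = AlgHom.id ℤ (MvPolynomial X ℤ) := by
    apply MvPolynomial.algHom_ext
    intro z
    simp [epsHom, eMap]
  exact AlgHom.congr_fun this P

theorem tauHom_ker {X : Type*} (V : Set X) (W : Finset X) (hWV : ∀ i ∈ W, i ∈ V)
    {f : FracField X} (hf : f ∈ Radd X V) (h0 : tauHom W f = 0) :
    f ∈ ⨆ i ∈ W, Radd X (V \ {i}) := by
  classical
  obtain ⟨P, Q, hP, hQ, hQ', hPQ⟩ := mem_Radd.mp hf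
  obtain ⟨b, hb⟩ : ∃ b : X → ℤ, eval b Q ≠ 0 := by
    by_contra hcon
    push Not at hcon
    exact hQ'.ne_zero' (MvPolynomial.funext fun b => by rw [hcon b, map_zero])
  have hne : ∀ S : Finset X, epsHom b (rename (eMap S) Q) ≠ 0 := by
    intro S hS
    apply hb
    rw [← eval_epsHom b S, hS, map_zero]
  let φ : MvPolynomial (X ⊕ X) ℤ →+* FracField X :=
    (algebraMap (MvPolynomial X ℤ) (FracField X)).comp (epsHom b).toRingHom
  have hφ : ∀ R, φ R = algebraMap (MvPolynomial X ℤ) (FracField X) (epsHom b R) := fun R => rfl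
  have hz := frac_sum_eq_zero φ W.powerset
    (fun S => ((-1 : ℤ) ^ S.card) • rename (eMap S) P) (fun S => rename (eMap S) Q) ?_ ?_
  rotate_left
  · intro S _
    rw [hφ]
    exact algebraMap_frac_ne_zero (hne S)
  · rw [← h0, tauHom_apply, hPQ]
    refine Finset.sum_congr rfl fun S _ => ?_
    rw [sigmaHom_div, map_zsmul, smul_div_assoc]
  have hemp : ∅ ∈ W.powerset := Finset.empty_mem_powerset W
  rw [← Finset.add_sum_erase _ _ hemp] at hz
  have hcom := exists_common (⨆ i ∈ W, Radd X (V \ {i})) (W.powerset.erase ∅)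
    (fun S => φ (((-1 : ℤ) ^ S.card) • rename (eMap S) P) / φ (rename (eMap S) Q)) ?_
  · obtain ⟨c, hc, hmem⟩ := hcom
    rw [eq_neg_of_add_eq_zero_right hz] at hmem
    refine torsion_int V W hWV c hc f hf ?_
    have := neg_mem hmem
    rw [mul_neg, neg_neg] at this
    simp only [Finset.card_empty, pow_zero, one_smul, hφ, epsHom_empty] at this
    rwa [hPQ]
  · intro S hS
    obtain ⟨hSne, hSW⟩ := Finset.mem_erase.mp hS
    obtain ⟨w, hw⟩ := Finset.nonempty_iff_ne_empty.mpr hSne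
    obtain ⟨c, r, hc, hr, hcr⟩ := exists_primitive _ (hne S)
    refine ⟨c, hc, ?_⟩
    have hwW := Finset.mem_powerset.mp hSW hw
    refine (le_biSup (fun i => Radd X (V \ {i})) hwW) ?_
    have hQs := epsHom_supported b V hw hQ
    rw [hcr] at hQs
    have hPs := epsHom_supported b V hw hP
    have hc' : (c : FracField X) ≠ 0 := by exact_mod_cast hc
    have hr' := algebraMap_frac_ne_zero hr.ne_zero'
    have heq : (c : FracField X) * (φ (((-1 : ℤ) ^ S.card) • rename (eMap S) P) /
        φ (rename (eMap S) Q)) = ((-1 : ℤ) ^ S.card) •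
          (algebraMap _ (FracField X) (epsHom b (rename (eMap S) P)) /
            algebraMap _ (FracField X) r) := by
      rw [map_zsmul, hφ, hφ, hcr, map_mul]
      have hC : algebraMap (MvPolynomial X ℤ) (FracField X) (C c) = (c : FracField X) := by simp
      rw [hC, smul_div_assoc, mul_smul_comm]
      congr 1
      field_simp
    rw [heq]
    exact zsmul_mem (mem_Radd.mpr ⟨_, _, hPs, mem_supported_of_C_mul hc hQs, hr, rfl⟩) _

theorem main_free {X : Type*} (V : Set X) (hV : V.Countable) (W : Finset X)
    (hWV : ∀ i ∈ W, i ∈ V) :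
    Module.Free ℤ (Radd X V ⧸ (⨆ i ∈ W, Radd X (V \ {i})).addSubgroupOf (Radd X V)) := by
  classical
  haveI := countable_Radd hV
  let N := (⨆ i ∈ W, Radd X (V \ {i})).addSubgroupOf (Radd X V)
  have hN : ∀ g ∈ N, (tauHom W).comp (Radd X V).subtype g = 0 := by
    intro g hg
    have hg' : (g : FracField X) ∈ ⨆ i ∈ W, Radd X (V \ {i}) := AddSubgroup.mem_addSubgroupOf.mp hg
    obtain ⟨a, ha, hsum⟩ := mem_biSup_exists _ W hg'
    change tauHom W (g : FracField X) = 0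
    rw [← hsum, map_sum]
    exact Finset.sum_eq_zero fun i hi => tauHom_zero V W hi (ha i hi)
  let L : (Radd X V ⧸ N) →+ FracField (X ⊕ X) := QuotientAddGroup.lift N _ hN
  have hLmk : ∀ g : Radd X V, L (QuotientAddGroup.mk g) = tauHom W (g : FracField X) :=
    fun g => rfl
  have hL : Function.Injective L := by
    rw [injective_iff_map_eq_zero]
    intro y hy
    induction y using QuotientAddGroup.induction_on with
    | H g =>
      rw [hLmk] at hy
      rw [QuotientAddGroup.eq_zero_iff]
      exact AddSubgroup.mem_addSubgroupOf.mpr (tauHom_ker V W hWV g.2 hy)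
  have hLmem : ∀ y, L y ∈ Rset (X ⊕ X) Set.univ := by
    intro y
    induction y using QuotientAddGroup.induction_on with
    | H g => rw [hLmk]; exact mem_Radd.mp (tauHom_mem V W g.2)
  let L' : (Radd X V ⧸ N) →ₗ[ℤ] FracField (X ⊕ X) := L.toIntLinearMap
  haveI : Countable (Radd X V ⧸ N) := Quotient.countable
  haveI : Module.IsTorsionFree ℤ (Radd X V ⧸ N) := by
    rw [Module.isTorsionFree_iff_smul_eq_zero]
    intro m y hy
    have := congrArg L hy
    rw [map_zsmul, map_zero, zsmul_eq_mul, mul_eq_zero] at this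
    rcases this with h | h
    · left; exact_mod_cast h
    · right; exact hL (by rw [h, map_zero])
  refine PT_free (M := Radd X V ⧸ N) fun S => ?_
  obtain ⟨N', hfg, hN'⟩ := pure_closure_fg (S.image L) (by
    intro s hs
    obtain ⟨y, _, rfl⟩ := Finset.mem_image.mp hs
    exact hLmem y)
  refine ⟨N'.comap L', ?_, ?_⟩
  · refine Submodule.fg_of_fg_map_injective L' hL (hfg.of_le ?_)
    exact Submodule.map_comap_le _ _
  · intro m g hm hg
    refine hN' m (L g) hm (hLmem g) ?_
    have h1 := Submodule.mem_map_of_mem (f := L') hg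
    rw [Submodule.map_span, map_zsmul] at h1
    rw [Finset.coe_image]
    exact h1

end partD

/-- Let `Y ⊆ X` be countable, `n ≥ 0`, and `x 1, …, x n ∈ X \ Y`
pairwise distinct; put `W = {x 1, …, x n}`, `W(i) = W \ {x i}`, `G = R⁺_{W ∪ Y}` and
`I = Σ_i R⁺_{W(i) ∪ Y}` (the additive subgroup generated by the `R⁺_{W(i) ∪ Y}`).
Then `G / I` is a free abelian group. -/
theorem quotient_free_of_countable {X : Type*} (Y : Set X) (hY : Y.Countable)
    (n : ℕ) (x : Fin n → X)
    (hinj : Function.Injective x) (hxY : ∀ i, x i ∉ Y) :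
    Module.Free ℤ
      ((Radd X (Set.range x ∪ Y)) ⧸
        ((⨆ i : Fin n, Radd X ((Set.range x \ {x i}) ∪ Y)).addSubgroupOf
          (Radd X (Set.range x ∪ Y)))) := by
  classical
  have hset : ∀ i, (Set.range x \ {x i}) ∪ Y = (Set.range x ∪ Y) \ {x i} := by
    intro i
    ext z
    constructor
    · rintro (⟨h1, h2⟩ | h)
      · exact ⟨Or.inl h1, h2⟩
      · refine ⟨Or.inr h, fun hz => hxY i ?_⟩
        rw [Set.mem_singleton_iff] at hz
        exact hz ▸ h
    · rintro ⟨h1 | h1, h2⟩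
      · exact Or.inl ⟨h1, h2⟩
      · exact Or.inr h1
  have hI : (⨆ i : Fin n, Radd X ((Set.range x \ {x i}) ∪ Y)) =
      ⨆ w ∈ Finset.univ.image x, Radd X ((Set.range x ∪ Y) \ {w}) := by
    simp only [hset]
    rw [Finset.iSup_finset_image]
    simp
  rw [hI]
  refine main_free _ ((Set.countable_range x).union hY) _ ?_
  intro w hw
  obtain ⟨i, _, rfl⟩ := Finset.mem_image.mp hw
  exact Or.inl ⟨i, rfl⟩
end

section
/- Let X be a set, Y ⊆ X, n ≥ 0, and x(1),…,x(n) ∈ X∖Y pairwise distinct; put W = {x(1),…,x(n)}, W(i) = W∖{x(i)}, G = R⁺_{W∪Y}, and I = Σ_{i=1}^{n} R⁺_{W(i)∪Y}. If a₁ + I,…,a_k + I are ℤ-linearly independent elements of G/I, then the set { m ∈ ℤ, m ≥ 1 : there exist integers q₁,…,q_k, not all zero and with no common divisor > 1, such that q₁(a₁+I) + ⋯ + q_k(a_k+I) is divisible by m in G/I } is finite. -/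
set_option synthInstance.maxHeartbeats 1000000
set_option maxHeartbeats 1000000

namespace DivFin

theorem lemA {M : Type*} [AddCommGroup M] [Module.Finite ℤ M] {k : ℕ} (v : Fin k → M)
    (hv : LinearIndependent ℤ v) : ∃ N : ℤ, N ≠ 0 ∧ ∀ (m : ℤ) (q : Fin k → ℤ) (c : M), m ≠ 0 →
      ∑ i, q i • v i = m • c → ∀ i, m ∣ N * q i := by
  let L := Submodule.span ℤ (Set.range v)
  have hfin : Module.Finite ℤ (Submodule.torsion ℤ (M ⧸ L)) := inferInstance
  have ht : Module.IsTorsion ℤ (Submodule.torsion ℤ (M ⧸ L)) := Submodule.torsion_isTorsion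
  have hne := Submodule.annihilator_top_inter_nonZeroDivisors ht
  obtain ⟨N, hN1, hN2⟩ := hne
  refine ⟨N, nonZeroDivisors.ne_zero hN2, ?_⟩
  intro m q c hm h
  have hc : L.mkQ c ∈ Submodule.torsion ℤ (M ⧸ L) := by
    rw [Submodule.mem_torsion_iff]
    refine ⟨⟨m, mem_nonZeroDivisors_of_ne_zero hm⟩, ?_⟩
    change m • L.mkQ c = 0
    rw [← map_smul, ← h, Submodule.mkQ_apply, Submodule.Quotient.mk_eq_zero]
    exact Submodule.sum_mem _ fun i _ => Submodule.smul_mem _ _ (Submodule.subset_span ⟨i, rfl⟩)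
  have h2 : N • (⟨L.mkQ c, hc⟩ : Submodule.torsion ℤ (M ⧸ L)) = 0 :=
    Submodule.mem_annihilator.1 hN1 _ trivial
  have h3 : N • L.mkQ c = 0 := congrArg Subtype.val h2
  rw [← map_smul, Submodule.mkQ_apply, Submodule.Quotient.mk_eq_zero] at h3
  obtain ⟨t, ht⟩ := (Submodule.mem_span_range_iff_exists_fun ℤ).1 h3
  have h4 : ∑ i, (N * q i - m * t i) • v i = 0 := by
    simp only [sub_smul, mul_smul, Finset.sum_sub_distrib, ← Finset.smul_sum]
    rw [h, ht, smul_comm, sub_self]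
  intro i
  have := Fintype.linearIndependent_iff.1 hv _ h4 i
  exact ⟨t i, by linarith⟩

theorem gcdl {k : ℕ} (N m : ℤ) (q : Fin k → ℤ) (h0 : ∃ i, q i ≠ 0)
    (hd : ∀ d : ℤ, 1 < d → ¬ (∀ i, d ∣ q i)) (h : ∀ i, m ∣ N * q i) : m ∣ N := by
  have h1 : m ∣ Finset.univ.gcd (fun i => N * q i) := Finset.dvd_gcd fun i _ => h i
  rw [Finset.gcd_mul_left] at h1
  have h2 : Finset.univ.gcd q = 1 := by
    have hz : Finset.univ.gcd q ≠ 0 := by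
      rw [Ne, Finset.gcd_eq_zero_iff]
      obtain ⟨i, hi⟩ := h0
      exact fun h => hi (h i (Finset.mem_univ i))
    have hnn : 0 ≤ Finset.univ.gcd q := by
      rw [← Finset.normalize_gcd]; exact Int.nonneg_of_normalize_eq_self (normalize_idem _)
    by_contra hne
    exact hd (Finset.univ.gcd q) (by omega) fun i => Finset.gcd_dvd (Finset.mem_univ i)
  rw [h2, mul_one] at h1
  exact (dvd_normalize_iff).1 h1

theorem fracsum {ι A K : Type*} [CommRing A] [Field K] [DecidableEq ι] (φ : A →+* K) (s : Finset ι)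
   (e : ι → ℤ) (p q : ι → A) (hq : ∀ i ∈ s, φ (q i) ≠ 0) :
   (∑ i ∈ s, e i • (φ (p i) / φ (q i))) * φ (∏ i ∈ s, q i)
     = φ (∑ i ∈ s, e i • (p i * ∏ j ∈ s.erase i, q j)) := by
  rw [map_sum, Finset.sum_mul]
  refine Finset.sum_congr rfl fun i hi => ?_
  rw [map_zsmul, map_mul, ← Finset.mul_prod_erase s q hi, map_mul, smul_mul_assoc]
  have := hq i hi
  field_simp

open MvPolynomial

theorem prim_iff {V : Type*} (q : MvPolynomial V ℤ) :
    MvPrimitive q ↔ ∀ p : ℕ, p.Prime → ¬ (C (p : ℤ) ∣ q) := by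
  constructor
  · intro h p hp
    exact h p (by exact_mod_cast hp.one_lt)
  · intro h m hm hd
    obtain ⟨p, hp, hpm⟩ := Int.exists_prime_and_dvd (n := m) (by omega)
    refine h p.natAbs (Int.prime_iff_natAbs_prime.1 hp) (dvd_trans ?_ hd)
    exact map_dvd C (Int.natAbs_dvd.2 hpm)

theorem prim_ne {V : Type*} {q : MvPolynomial V ℤ} (h : MvPrimitive q) : q ≠ 0 := by
  rintro rfl
  exact h 2 (by norm_num) (dvd_zero _)

theorem prim_one {V : Type*} : MvPrimitive (1 : MvPolynomial V ℤ) := by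
  intro m hm hd
  have := (C_dvd_iff_dvd_coeff m 1).1 hd 0
  rw [coeff_zero_one] at this
  have := Int.le_of_dvd one_pos this
  omega

theorem prime_Cp {V : Type*} {p : ℕ} (hp : p.Prime) : Prime (C (p : ℤ) : MvPolynomial V ℤ) :=
  (MvPolynomial.prime_C_iff V).2 (Nat.prime_iff_prime_int.1 hp)

theorem prim_mul {V : Type*} {a b : MvPolynomial V ℤ} (ha : MvPrimitive a) (hb : MvPrimitive b) :
    MvPrimitive (a * b) := by
  rw [prim_iff] at *
  intro p hp hd
  rcases (prime_Cp hp).dvd_or_dvd hd with h | h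
  · exact ha p hp h
  · exact hb p hp h

theorem prim_prod {V ι : Type*} (s : Finset ι) (f : ι → MvPolynomial V ℤ)
    (h : ∀ i ∈ s, MvPrimitive (f i)) : MvPrimitive (∏ i ∈ s, f i) :=
  Finset.prod_induction f MvPrimitive (fun _ _ => prim_mul) prim_one h

theorem gauss_nat {V : Type*} {s : MvPolynomial V ℤ} (hs : MvPrimitive s) (m : ℕ) :
    m ≠ 0 → ∀ t : MvPolynomial V ℤ, C (m : ℤ) ∣ s * t → C (m : ℤ) ∣ t := by
  induction m using induction_on_primes with
  | zero => intro h; exact absurd rfl h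
  | one => intro _ t _; simp
  | prime_mul p a hp ih =>
    intro h0 t hd
    have ha : a ≠ 0 := by rintro rfl; simp at h0
    rw [Nat.cast_mul, C_mul] at *
    have h1 : C (p : ℤ) ∣ s * t := dvd_trans (dvd_mul_right _ _) hd
    rcases (prime_Cp hp).dvd_or_dvd h1 with h | ⟨u, rfl⟩
    · exact absurd h ((prim_iff s).1 hs p hp)
    · rw [mul_left_comm] at hd
      exact mul_dvd_mul_left _ (ih ha u ((mul_dvd_mul_iff_left (prime_Cp hp).ne_zero).1 hd))

theorem gauss {V : Type*} {s t : MvPolynomial V ℤ} (hs : MvPrimitive s) {m : ℤ} (hm : 1 ≤ m)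
    (h : C m ∣ s * t) : C m ∣ t := by
  lift m to ℕ using by omega
  exact gauss_nat hs m (by omega) t h

theorem content {V : Type*} {q : MvPolynomial V ℤ} (hq : q ≠ 0) :
    ∃ (N : ℤ) (q' : MvPolynomial V ℤ), N ≠ 0 ∧ MvPrimitive q' ∧ q = C N * q' := by
  have hd : C (q.support.gcd (fun i => q.coeff i)) ∣ q := by
    rw [C_dvd_iff_dvd_coeff]
    intro i
    by_cases hi : i ∈ q.support
    · exact Finset.gcd_dvd hi
    · rw [notMem_support_iff.1 hi]; exact dvd_zero _
  obtain ⟨q', hq'⟩ := hd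
  have hN : q.support.gcd (fun i => q.coeff i) ≠ 0 := by
    intro h
    rw [h, C_0, zero_mul] at hq'
    exact hq hq'
  refine ⟨_, q', hN, ?_, hq'⟩
  intro m hm hmq
  have h1 : C (q.support.gcd (fun i => q.coeff i) * m) ∣ q := by
    rw [C_mul]
    conv_rhs => rw [hq']
    exact mul_dvd_mul_left _ hmq
  rw [C_dvd_iff_dvd_coeff] at h1
  have h2 : q.support.gcd (fun i => q.coeff i) * m ∣ q.support.gcd (fun i => q.coeff i) * 1 := by
    rw [mul_one]
    exact Finset.dvd_gcd fun i _ => h1 i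
  have h3 := Int.le_of_dvd one_pos ((mul_dvd_mul_iff_left hN).1 h2)
  omega

theorem am_ne {V : Type*} {q : MvPolynomial V ℤ} (hq : q ≠ 0) :
    algebraMap (MvPolynomial V ℤ) (FracField V) q ≠ 0 := by
  simpa using hq

theorem mem_Radd {V : Type*} {Z : Set V} {f : FracField V} (hf : f ∈ Radd V Z) : f ∈ Rset V Z := by
  induction hf using AddSubgroup.closure_induction with
  | mem x hx => exact hx
  | zero => exact ⟨0, 1, zero_mem _, one_mem _, prim_one, by simp⟩
  | add x y _ _ hx hy =>
    obtain ⟨p, q, hp, hq, hq1, rfl⟩ := hx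
    obtain ⟨p', q', hp', hq', hq1', rfl⟩ := hy
    refine ⟨p * q' + q * p', q * q', add_mem (mul_mem hp hq') (mul_mem hq hp'), mul_mem hq hq',
      prim_mul hq1 hq1', ?_⟩
    have h1 := am_ne (prim_ne hq1)
    have h2 := am_ne (prim_ne hq1')
    rw [div_add_div _ _ h1 h2]
    simp only [map_add, map_mul]
  | neg x _ hx =>
    obtain ⟨p, q, hp, hq, hq1, rfl⟩ := hx
    exact ⟨-p, q, neg_mem hp, hq, hq1, by rw [map_neg, neg_div]⟩

/-- fractions become members of `Radd` after multiplication by a nonzero integer -/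
theorem tors_frac {V : Type*} {Z : Set V} {p q : MvPolynomial V ℤ} (hp : p ∈ supported ℤ Z)
    (hq : q ∈ supported ℤ Z) (hq0 : q ≠ 0) : ∃ N : ℤ, N ≠ 0 ∧
      N • (algebraMap (MvPolynomial V ℤ) (FracField V) p / algebraMap _ (FracField V) q)
        ∈ Radd V Z := by
  obtain ⟨N, q', hN, hq', rfl⟩ := content hq0
  have hs : q' ∈ supported ℤ Z := by
    rw [mem_supported] at hq ⊢
    rwa [vars_C_mul _ hN] at hq
  refine ⟨N, hN, AddSubgroup.subset_closure ⟨p, q', hp, hs, hq', ?_⟩⟩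
  have h1 := am_ne (prim_ne hq')
  have h2 : algebraMap (MvPolynomial V ℤ) (FracField V) (C N) ≠ 0 := am_ne (by simpa using hN)
  have h3 : algebraMap (MvPolynomial V ℤ) (FracField V) (C N) = (N : FracField V) := by
    rw [← map_intCast (algebraMap (MvPolynomial V ℤ) (FracField V)),
      ← map_intCast (C : ℤ →+* MvPolynomial V ℤ), Int.cast_id]
  rw [map_mul, zsmul_eq_mul, ← h3]
  field_simp

/-- the case without quotient -/
theorem base {V : Type*} {k : ℕ} (b : Fin k → FracField V) (hb : ∀ i, b i ∈ Rset V Set.univ)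
    (hind : LinearIndependent ℤ b) : ∃ N : ℤ, N ≠ 0 ∧ ∀ (m : ℤ) (q : Fin k → ℤ) (c : FracField V),
      1 ≤ m → c ∈ Rset V Set.univ → ∑ i, q i • b i = m • c → ∀ i, m ∣ N * q i := by
  classical
  choose p s _ _ hs hps using hb
  let Q := ∏ i, s i
  have hQ : MvPrimitive Q := prim_prod _ _ fun i _ => hs i
  let P : Fin k → MvPolynomial V ℤ := fun i => p i * ∏ j ∈ Finset.univ.erase i, s j
  have key : ∀ g : Fin k → ℤ, (∑ i, g i • b i) * algebraMap _ (FracField V) Q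
      = algebraMap _ (FracField V) (∑ i, g i • P i) := by
    intro g
    rw [← fracsum (algebraMap (MvPolynomial V ℤ) (FracField V)) Finset.univ g p s
      (fun i _ => am_ne (prim_ne (hs i)))]
    simp only [hps, Q]
  let T : Finset (V →₀ ℕ) := Finset.univ.biUnion fun i => (P i).support
  let φ : MvPolynomial V ℤ →ₗ[ℤ] (T → ℤ) := LinearMap.pi fun t => lcoeff ℤ t.1
  have hφ : ∀ r t, φ r t = coeff t.1 r := fun r t => rfl
  have hli : LinearIndependent ℤ (fun i => φ (P i)) := by
    rw [Fintype.linearIndependent_iff] at hind ⊢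
    intro g hg
    apply hind g
    have h0 : ∑ i, g i • P i = 0 := by
      ext t
      by_cases ht : t ∈ T
      · have := congrFun hg ⟨t, ht⟩
        simp only [← map_smul, ← map_sum] at this
        exact this
      · rw [coeff_sum, coeff_zero]
        refine Finset.sum_eq_zero fun i _ => ?_
        have : coeff t (P i) = 0 := by
          rw [← notMem_support_iff]
          intro h
          exact ht (Finset.mem_biUnion.2 ⟨i, Finset.mem_univ _, h⟩)
        rw [coeff_smul, this, smul_zero]
    have := key g
    rw [h0, map_zero] at this
    exact (mul_eq_zero.1 this).resolve_right (am_ne (prim_ne hQ))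
  obtain ⟨N, hN, hN2⟩ := lemA _ hli
  refine ⟨N, hN, ?_⟩
  rintro m q c hm ⟨r, u, -, -, hu, rfl⟩ h
  have hk := key q
  rw [h] at hk
  have h1 : C m * (r * Q) = u * ∑ i, q i • P i := by
    apply IsFractionRing.injective (MvPolynomial V ℤ) (FracField V)
    rw [map_mul _ u, ← hk, ← smul_eq_C_mul, map_zsmul, map_mul]
    have := am_ne (prim_ne hu)
    rw [smul_mul_assoc, mul_smul_comm]
    congr 1
    field_simp
  obtain ⟨w, hw⟩ := gauss hu hm ⟨_, h1.symm⟩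
  refine hN2 m q (φ w) (by omega) ?_
  rw [← smul_eq_C_mul] at hw
  rw [← map_smul, ← hw, map_sum]
  simp only [map_zsmul]

open Classical in
/-- tagging of the variables: those in `S` are replaced by fresh copies -/
noncomputable def tag {X : Type*} (S : Finset X) (v : X) : X × Bool := (v, decide (v ∈ S))

theorem tag_inj {X : Type*} (S : Finset X) : Function.Injective (tag S) := by
  intro v w h
  exact congrArg Prod.fst h

theorem subst_inj {X : Type*} (S : Finset X) : Function.Injective
    ((algebraMap (MvPolynomial (X × Bool) ℤ) (FracField (X × Bool))).comp
      (rename (tag S) : MvPolynomial X ℤ →ₐ[ℤ] MvPolynomial (X × Bool) ℤ).toRingHom) := by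
  rw [RingHom.coe_comp]
  exact (IsFractionRing.injective _ _).comp (rename_injective _ (tag_inj S))

/-- substitution of fresh variables for those in `S` -/
noncomputable def subst {X : Type*} (S : Finset X) : FracField X →+* FracField (X × Bool) :=
  IsFractionRing.lift (subst_inj S)

theorem subst_am {X : Type*} (S : Finset X) (p : MvPolynomial X ℤ) :
    subst S (algebraMap _ _ p) = algebraMap _ _ (rename (tag S) p) :=
  IsFractionRing.lift_algebraMap (subst_inj S) p

/-- the iterated difference operator -/
noncomputable def D {X : Type*} (W : Finset X) : FracField X →+ FracField (X × Bool) :=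
  ∑ S ∈ W.powerset, ((-1 : ℤ) ^ S.card) • (subst S).toAddMonoidHom

theorem D_apply {X : Type*} (W : Finset X) (f : FracField X) :
    D W f = ∑ S ∈ W.powerset, ((-1 : ℤ) ^ S.card) • subst S f := by
  simp only [D, AddMonoidHom.finsetSum_apply]
  rfl

theorem rename_congr {X : Type*} {Z : Set X} {S T : Finset X}
    (h : ∀ v ∈ Z, (v ∈ S ↔ v ∈ T)) {p : MvPolynomial X ℤ} (hp : p ∈ supported ℤ Z) :
    rename (tag S) p = rename (tag T) p := by
  have : supported ℤ Z ≤ AlgHom.equalizer (rename (R := ℤ) (tag S)) (rename (tag T)) := by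
    rw [supported_eq_adjoin_X]
    refine Algebra.adjoin_le ?_
    rintro _ ⟨v, hv, rfl⟩
    change rename (tag S) (MvPolynomial.X v) = rename (tag T) (MvPolynomial.X v)
    have ht : tag S v = tag T v := by
      unfold tag
      rw [decide_eq_decide.2 (h v hv)]
    rw [rename_X, rename_X, ht]
  exact this hp

theorem D_kill {X : Type*} {W : Finset X} {Z : Set X} {x : X} (hx : x ∈ W) (hZ : x ∉ Z)
    {f : FracField X} (hf : f ∈ Rset X Z) : D W f = 0 := by
  classical
  obtain ⟨p, q, hp, hq, -, rfl⟩ := hf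
  rw [D_apply, ← Finset.insert_erase hx, Finset.sum_powerset_insert (Finset.notMem_erase x W),
    ← Finset.sum_add_distrib]
  refine Finset.sum_eq_zero fun S hS => ?_
  have hxS : x ∉ S := fun h => Finset.notMem_erase x W (Finset.mem_powerset.1 hS h)
  have hiff : ∀ v ∈ Z, (v ∈ insert x S ↔ v ∈ S) := by
    intro v hv
    rw [Finset.mem_insert]
    constructor
    · rintro (rfl | h)
      · exact absurd hv hZ
      · exact h
    · exact Or.inr
  rw [map_div₀, map_div₀, subst_am, subst_am, subst_am, subst_am, rename_congr hiff hp,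
    rename_congr hiff hq, Finset.card_insert_of_notMem hxS, pow_succ, mul_neg_one, neg_smul,
    add_neg_cancel]

theorem rename_prim {X V : Type*} {g : X → V} (hg : Function.Injective g) {q : MvPolynomial X ℤ}
    (hq : MvPrimitive q) : MvPrimitive (rename g q) := by
  intro m hm hd
  refine hq m hm ?_
  rw [C_dvd_iff_dvd_coeff] at hd ⊢
  intro i
  have := hd (i.mapDomain g)
  rwa [coeff_rename_mapDomain g hg] at this

theorem D_mem {X : Type*} (W : Finset X) {Z : Set X} {f : FracField X} (hf : f ∈ Rset X Z) :
    D W f ∈ Rset (X × Bool) Set.univ := by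
  apply mem_Radd
  rw [D_apply]
  refine sum_mem fun S _ => zsmul_mem (AddSubgroup.subset_closure ?_) _
  obtain ⟨p, q, hp, hq, hq1, rfl⟩ := hf
  refine ⟨rename (tag S) p, rename (tag S) q, by simp, by simp,
    rename_prim (tag_inj S) hq1, ?_⟩
  rw [map_div₀, subst_am, subst_am]

/-- specialization of the fresh variables to integers -/
noncomputable def spec {X : Type*} (c : X → ℤ) : MvPolynomial (X × Bool) ℤ →ₐ[ℤ] MvPolynomial X ℤ :=
  aeval fun v => if v.2 = true then C (c v.1) else MvPolynomial.X v.1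

theorem spec_empty {X : Type*} (c : X → ℤ) (p : MvPolynomial X ℤ) :
    spec c (rename (tag ∅) p) = p := by
  rw [spec, aeval_rename]
  have : ((fun v : X × Bool => if v.2 = true then C (c v.1) else MvPolynomial.X v.1) ∘ tag ∅
      : X → MvPolynomial X ℤ) = MvPolynomial.X := by
    funext v
    simp [tag]
  rw [this, aeval_X_left_apply]

theorem spec_supp {X : Type*} (c : X → ℤ) {S : Finset X} {x : X} (hx : x ∈ S) {Z : Set X}
    {p : MvPolynomial X ℤ} (hp : p ∈ supported ℤ Z) :
    spec c (rename (tag S) p) ∈ supported ℤ (Z \ {x}) := by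
  have : supported ℤ Z ≤ (supported ℤ (Z \ {x})).comap ((spec c).comp (rename (tag S))) := by
    rw [supported_eq_adjoin_X (s := Z)]
    refine Algebra.adjoin_le ?_
    rintro _ ⟨v, hv, rfl⟩
    change spec c (rename (tag S) (MvPolynomial.X v)) ∈ supported ℤ (Z \ {x})
    rw [rename_X, spec, aeval_X]
    by_cases h : v ∈ S
    · simp only [tag, h, decide_true, if_true]
      exact Subalgebra.algebraMap_mem _ _
    · simp only [tag, h, decide_false]
      refine X_mem_supported.2 ⟨hv, ?_⟩
      rintro rfl
      exact h hx
  exact this hp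

theorem spec_exists {X : Type*} {Q : MvPolynomial (X × Bool) ℤ} (hQ : Q ≠ 0) :
    ∃ c : X → ℤ, spec c Q ≠ 0 := by
  have : ∃ e, eval e Q ≠ 0 := by
    by_contra! h
    exact hQ (MvPolynomial.funext fun e => by rw [h, map_zero])
  obtain ⟨e, he⟩ := this
  refine ⟨fun v => e (v, true), fun h => he ?_⟩
  have h2 : ((aeval fun v : X => e (v, false)).comp (spec fun v => e (v, true)) :
      MvPolynomial (X × Bool) ℤ →ₐ[ℤ] ℤ) = aeval e := by
    ext ⟨v, b⟩
    cases b <;> simp [spec]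
  have h3 := DFunLike.congr_fun h2 Q
  rw [AlgHom.comp_apply, h, map_zero] at h3
  rw [← coe_aeval_eq_eval]
  exact h3.symm

theorem tors_sum {ι G : Type*} [AddCommGroup G] (I : AddSubgroup G) (s : Finset ι) (f : ι → G)
    (h : ∀ i ∈ s, ∃ N : ℤ, N ≠ 0 ∧ N • f i ∈ I) : ∃ N : ℤ, N ≠ 0 ∧ N • ∑ i ∈ s, f i ∈ I := by
  refine Finset.sum_induction f (fun g => ∃ N : ℤ, N ≠ 0 ∧ N • g ∈ I) ?_
    ⟨1, one_ne_zero, by simp⟩ h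
  rintro a b ⟨N, hN, ha⟩ ⟨M, hM, hb⟩
  refine ⟨N * M, mul_ne_zero hN hM, ?_⟩
  rw [smul_add]
  refine add_mem ?_ ?_
  · rw [mul_comm, mul_smul]; exact zsmul_mem ha _
  · rw [mul_smul]; exact zsmul_mem hb _

theorem D_ker {X : Type*} {W : Finset X} {Z : Set X} {f : FracField X} (hf : f ∈ Rset X Z)
    (I : AddSubgroup (FracField X)) (hI : ∀ x ∈ W, Radd X (Z \ {x}) ≤ I) (h0 : D W f = 0) :
    ∃ N : ℤ, N ≠ 0 ∧ N • f ∈ I := by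
  classical
  obtain ⟨p, q, hp, hq, hq1, rfl⟩ := hf
  have hqS : ∀ S : Finset X, rename (tag S) q ≠ 0 := fun S => prim_ne (rename_prim (tag_inj S) hq1)
  obtain ⟨c, hc⟩ := spec_exists (Finset.prod_ne_zero_iff.2 fun S (_ : S ∈ W.powerset) => hqS S)
  have hcS : ∀ S ∈ W.powerset, spec c (rename (tag S) q) ≠ 0 := by
    rw [map_prod] at hc
    exact Finset.prod_ne_zero_iff.1 hc
  have e1 := fracsum (algebraMap (MvPolynomial (X × Bool) ℤ) (FracField (X × Bool))) W.powerset
    (fun S => (-1) ^ S.card) (fun S => rename (tag S) p) (fun S => rename (tag S) q)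
    (fun S _ => am_ne (hqS S))
  have e2 := fracsum ((algebraMap (MvPolynomial X ℤ) (FracField X)).comp (spec c).toRingHom)
    W.powerset
    (fun S => (-1) ^ S.card) (fun S => rename (tag S) p) (fun S => rename (tag S) q)
    (fun S hS => am_ne (hcS S hS))
  rw [D_apply] at h0
  simp only [map_div₀, subst_am] at h0
  rw [h0, zero_mul] at e1
  rw [(map_eq_zero_iff _ (IsFractionRing.injective _ _)).1 e1.symm, map_zero] at e2
  have e3 := (mul_eq_zero.1 e2).resolve_right (am_ne hc)
  rw [← Finset.add_sum_erase _ _ (Finset.empty_mem_powerset W)] at e3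
  simp only [RingHom.comp_apply, Finset.card_empty, pow_zero, one_smul] at e3
  change algebraMap _ _ (spec c (rename (tag ∅) p)) / algebraMap _ _ (spec c (rename (tag ∅) q))
    + _ = 0 at e3
  rw [spec_empty, spec_empty] at e3
  rw [eq_neg_of_add_eq_zero_left e3]
  simp only [smul_neg, neg_mem_iff]
  apply tors_sum
  intro S hS
  obtain ⟨hS1, hS2⟩ := Finset.mem_erase.1 hS
  obtain ⟨x, hx⟩ := Finset.nonempty_iff_ne_empty.2 hS1
  obtain ⟨N, hN, hm⟩ := tors_frac (spec_supp c hx hp) (spec_supp c hx hq) (hcS S hS2)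
  refine ⟨N, hN, ?_⟩
  rw [smul_comm]
  exact zsmul_mem (hI x (Finset.mem_powerset.1 hS2 hx) hm) _

theorem final {X : Type*} (W : Finset X) (Z : Set X) (G I : AddSubgroup (FracField X))
    (hG : ∀ f ∈ G, f ∈ Rset X Z) (hkill : ∀ f ∈ I, D W f = 0)
    (hRI : ∀ v ∈ W, Radd X (Z \ {v}) ≤ I) (k : ℕ) (a : Fin k → G)
    (hind : LinearIndependent ℤ fun i : Fin k =>
      (QuotientAddGroup.mk (a i) : G ⧸ I.addSubgroupOf G)) :
    {m : ℤ | 1 ≤ m ∧ ∃ q : Fin k → ℤ, (∃ i, q i ≠ 0) ∧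
        (∀ d : ℤ, 1 < d → ¬ (∀ i, d ∣ q i)) ∧
        ∃ c, (∑ i, q i • (QuotientAddGroup.mk (a i) : G ⧸ I.addSubgroupOf G))
          = m • c}.Finite := by
  have hmk : ∀ g : G, (QuotientAddGroup.mk g : G ⧸ I.addSubgroupOf G) = 0 ↔ (g : FracField X) ∈ I := by
    intro g
    rw [QuotientAddGroup.eq_zero_iff, AddSubgroup.mem_addSubgroupOf]
  have hsum : ∀ g : Fin k → ℤ, (∑ i, g i • (QuotientAddGroup.mk (a i) : G ⧸ I.addSubgroupOf G))
      = QuotientAddGroup.mk (∑ i, g i • a i) := by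
    intro g
    change _ = QuotientAddGroup.mk' _ (∑ i, g i • a i)
    rw [map_sum]
    simp only [map_zsmul]
    rfl
  have hDsum : ∀ g : Fin k → ℤ, D W ((∑ i, g i • a i : G) : FracField X)
      = ∑ i, g i • D W (a i : FracField X) := by
    intro g
    rw [AddSubgroup.val_finsetSum, map_sum]
    simp only [AddSubgroup.coe_zsmul, map_zsmul]
  have hli : LinearIndependent ℤ (fun i => D W (a i : FracField X)) := by
    rw [Fintype.linearIndependent_iff] at hind ⊢
    intro g hg
    rw [← hDsum] at hg
    obtain ⟨N, hN, hm⟩ := D_ker (hG _ (∑ i, g i • a i : G).2) I hRI hg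
    have h1 := hind (fun i => N * g i) (by
      rw [hsum, hmk]
      simp only [mul_smul, ← Finset.smul_sum]
      exact hm)
    intro i
    exact (mul_eq_zero.1 (h1 i)).resolve_left hN
  obtain ⟨N, hN, hdvd⟩ := base _ (fun i => D_mem W (hG _ (a i).2)) hli
  refine (Set.finite_Icc (1 : ℤ) |N|).subset ?_
  rintro m ⟨hm, q, hq0, hq, c, hc⟩
  obtain ⟨c, rfl⟩ := QuotientAddGroup.mk_surjective c
  have h1 : (QuotientAddGroup.mk (∑ i, q i • a i - m • c) : G ⧸ I.addSubgroupOf G) = 0 := by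
    rw [QuotientAddGroup.mk_sub, ← hsum, hc, QuotientAddGroup.mk_zsmul, sub_self]
  rw [hmk] at h1
  have h2 := hkill _ h1
  rw [AddSubgroup.coe_sub, map_sub, hDsum, sub_eq_zero, AddSubgroup.coe_zsmul, map_zsmul] at h2
  have h3 := gcdl N m q hq0 hq
    (hdvd m q _ hm (D_mem W (hG _ c.2)) h2)
  exact ⟨hm, Int.le_of_dvd (abs_pos.2 hN) ((dvd_abs _ _).2 h3)⟩

end DivFin

/-- With `G = R⁺_{W ∪ Y}` and `I = Σ_i R⁺_{W(i) ∪ Y}` as before, if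
`a 1 + I, …, a k + I` are `ℤ`-linearly independent in `G / I`, then the set of
integers `m ≥ 1` for which there exist integers `q 1, …, q k`, not all zero and with
no common divisor `> 1`, such that `q 1 • (a 1 + I) + ⋯ + q k • (a k + I)` is
divisible by `m` in `G / I`, is finite. -/
theorem divisors_finite {X : Type*} (Y : Set X) (n : ℕ) (x : Fin n → X)
    (hinj : Function.Injective x) (hxY : ∀ i, x i ∉ Y)
    (k : ℕ) (a : Fin k → ↥(Radd X (Set.range x ∪ Y)))
    (hind : LinearIndependent ℤ fun i : Fin k =>
      (QuotientAddGroup.mk (a i) :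
        (Radd X (Set.range x ∪ Y)) ⧸
          ((⨆ ℓ : Fin n, Radd X ((Set.range x \ {x ℓ}) ∪ Y)).addSubgroupOf
            (Radd X (Set.range x ∪ Y))))) :
    {m : ℤ | 1 ≤ m ∧ ∃ q : Fin k → ℤ, (∃ i, q i ≠ 0) ∧
        (∀ d : ℤ, 1 < d → ¬ (∀ i, d ∣ q i)) ∧
        ∃ c, (∑ i, q i • (QuotientAddGroup.mk (a i) :
          (Radd X (Set.range x ∪ Y)) ⧸
            ((⨆ ℓ : Fin n, Radd X ((Set.range x \ {x ℓ}) ∪ Y)).addSubgroupOf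
              (Radd X (Set.range x ∪ Y))))) = m • c}.Finite := by
  classical
  let W : Finset X := Finset.univ.image x
  have hkill : ∀ f ∈ (⨆ ℓ : Fin n, Radd X ((Set.range x \ {x ℓ}) ∪ Y)), DivFin.D W f = 0 := by
    have : (⨆ ℓ : Fin n, Radd X ((Set.range x \ {x ℓ}) ∪ Y)) ≤ (DivFin.D W).ker := by
      refine iSup_le fun ℓ => ?_
      intro f hf
      refine DivFin.D_kill (x := x ℓ) (Finset.mem_image_of_mem x (Finset.mem_univ ℓ)) ?_
        (DivFin.mem_Radd hf)
      rintro (h | h)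
      · exact h.2 rfl
      · exact hxY ℓ h
    exact fun f hf => this hf
  have hRI : ∀ v ∈ W, Radd X ((Set.range x ∪ Y) \ {v}) ≤ (⨆ ℓ : Fin n, Radd X ((Set.range x \ {x ℓ}) ∪ Y)) := by
    intro v hv
    obtain ⟨ℓ, -, rfl⟩ := Finset.mem_image.1 hv
    refine le_trans ?_ (le_iSup (fun ℓ : Fin n => Radd X ((Set.range x \ {x ℓ}) ∪ Y)) ℓ)
    refine AddSubgroup.closure_mono ?_
    rintro f ⟨p, q, hp, hq, h1, h2⟩
    have hs : (Set.range x ∪ Y) \ {x ℓ} ⊆ (Set.range x \ {x ℓ}) ∪ Y := by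
      rintro v ⟨h | h, h'⟩
      · exact Or.inl ⟨h, h'⟩
      · exact Or.inr h
    exact ⟨p, q, MvPolynomial.supported_mono hs hp, MvPolynomial.supported_mono hs hq, h1, h2⟩
  exact DivFin.final W (Set.range x ∪ Y) _ _ (fun _ => DivFin.mem_Radd) hkill hRI k a hind
end

section
/- Let Y be a countable set of variables, n ≥ 0, and let x(1),…,x(n) and x₁(1),…,x₁(n) be 2n additional pairwise distinct variables not in Y; set W = {x(1),…,x(n)}, V = {x₁(1),…,x₁(n)}, W(i) = W∖{x(i)}, G = R⁺_{W∪Y}, and I = Σ_{i=1}^{n} R⁺_{W(i)∪Y}. For u ⊆ {1,…,n} let h_u be the field automorphism of ℚ(Y ∪ W ∪ V) induced by swapping x(q) and x₁(q) for q ∈ u and fixing all other variables. If a₁,…,a_k ∈ G are such that a₁ + I,…,a_k + I are ℤ-linearly independent in G/I, then the elements b_i = Σ_{u ⊆ {1,…,n}} (−1)^{|u|} h_u(a_i), i = 1,…,k, are linearly independent over ℚ in ℚ(Y ∪ W ∪ V). -/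
set_option synthInstance.maxHeartbeats 1000000
set_option maxHeartbeats 1000000

/-- The variables: `Sum.inl y` for `y ∈ Y`, `Sum.inr (Sum.inl q)` is `x(q)`, and
`Sum.inr (Sum.inr q)` is `x₁(q)`. -/
abbrev Var (Y : Type*) (n : ℕ) := Y ⊕ Fin n ⊕ Fin n

/-- The map on variables swapping `x(q)` and `x₁(q)` for `q ∈ u` and fixing all
other variables. -/
def swapFun {Y : Type*} {n : ℕ} (u : Finset (Fin n)) : Var Y n → Var Y n
  | .inl y => .inl y
  | .inr (.inl q) => if q ∈ u then .inr (.inr q) else .inr (.inl q)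
  | .inr (.inr q) => if q ∈ u then .inr (.inl q) else .inr (.inr q)

lemma swapFun_involutive {Y : Type*} {n : ℕ} (u : Finset (Fin n)) :
    Function.Involutive (swapFun (Y := Y) u) := by
  intro a
  rcases a with y | q | q
  · rfl
  · by_cases h : q ∈ u <;> simp [swapFun, h]
  · by_cases h : q ∈ u <;> simp [swapFun, h]

/-- The permutation of the variables swapping `x(q)` and `x₁(q)` for `q ∈ u` and
fixing all other variables. -/
def swapPerm {Y : Type*} {n : ℕ} (u : Finset (Fin n)) : Equiv.Perm (Var Y n) :=
  Function.Involutive.toPerm (swapFun u) (swapFun_involutive u)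

/-- The field automorphism `h_u` of `ℚ(Y ∪ W ∪ V)` induced by the permutation of
variables swapping `x(q)` and `x₁(q)` for `q ∈ u` and fixing all other variables. -/
noncomputable def swapAut (Y : Type*) (n : ℕ) (u : Finset (Fin n)) :
    FracField (Var Y n) ≃+* FracField (Var Y n) :=
  IsFractionRing.ringEquivOfRingEquiv (A := MvPolynomial (Var Y n) ℤ)
    (B := MvPolynomial (Var Y n) ℤ)
    (MvPolynomial.renameEquiv ℤ (swapPerm u)).toRingEquiv

open MvPolynomial in
lemma aux_content {X : Type*} {Z : Set X} (s : X →₀ ℕ) (N : ℕ) : ∀ d : MvPolynomial X ℤ,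
    d ∈ supported ℤ Z → coeff s d ≠ 0 → (coeff s d).natAbs ≤ N →
    ∃ (c : ℤ) (e : MvPolynomial X ℤ), c ≠ 0 ∧ e ∈ supported ℤ Z ∧ MvPrimitive e ∧
      d = C c * e := by
  induction N with
  | zero =>
    intro d _ h0 hN
    exact absurd (Int.natAbs_eq_zero.mp (Nat.le_zero.mp hN)) h0
  | succ N ih =>
    intro d hd h0 hN
    by_cases hp : MvPrimitive d
    · exact ⟨1, d, one_ne_zero, hd, hp, by simp⟩
    · unfold MvPrimitive at hp
      push Not at hp
      obtain ⟨m, hm, e, rfl⟩ := hp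
      have hm0 : m ≠ 0 := by omega
      rw [coeff_C_mul] at h0 hN
      have he0 : coeff s e ≠ 0 := right_ne_zero_of_mul h0
      have hes : e ∈ supported ℤ Z := by
        rw [mem_supported] at hd ⊢
        refine fun x hx => hd ?_
        simp only [Finset.mem_coe, mem_vars_iff_mem_support, mem_support_iff] at hx ⊢
        obtain ⟨t, ht, hxt⟩ := hx
        exact ⟨t, by rw [coeff_C_mul]; exact mul_ne_zero hm0 ht, hxt⟩
      have hlt : (coeff s e).natAbs ≤ N := by
        rw [Int.natAbs_mul] at hN
        have h1 : 2 ≤ m.natAbs := by omega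
        have h2 : 1 ≤ (coeff s e).natAbs := by omega
        nlinarith
      obtain ⟨c, f, hc, hf, hfp, rfl⟩ := ih e hes he0 hlt
      exact ⟨m * c, f, mul_ne_zero hm0 hc, hf, hfp, by rw [C_mul, mul_assoc]⟩

open MvPolynomial in
/-- A fraction with variables in `Z` has a nonzero integer multiple in `R_Z`. -/
lemma aux_mul_mem {X : Type*} {Z : Set X} (p d : MvPolynomial X ℤ)
    (hp : p ∈ supported ℤ Z) (hd : d ∈ supported ℤ Z) (hd0 : d ≠ 0) :
    ∃ c : ℤ, c ≠ 0 ∧ c • (algebraMap _ (FracField X) p / algebraMap _ (FracField X) d)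
      ∈ Radd X Z := by
  obtain ⟨s, hs⟩ := ne_zero_iff.mp hd0
  obtain ⟨c, e, hc, he, hep, rfl⟩ := aux_content s _ d hd hs le_rfl
  refine ⟨c, hc, AddSubgroup.subset_closure ⟨p, e, hp, he, hep, ?_⟩⟩
  have hC : (C c : MvPolynomial X ℤ) = (c : MvPolynomial X ℤ) := by simp
  have hcK : (c : FracField X) ≠ 0 := by exact_mod_cast hc
  have heK : algebraMap _ (FracField X) e ≠ 0 := by
    intro h
    rw [FaithfulSMul.algebraMap_eq_zero_iff] at h
    subst h; simp at hd0
  rw [map_mul, hC, map_intCast, zsmul_eq_mul]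
  field_simp

open MvPolynomial in
lemma aux_frac {X : Type*} {Z : Set X} (a : FracField X) (ha : a ∈ Radd X Z) :
    ∃ p d : MvPolynomial X ℤ, p ∈ supported ℤ Z ∧ d ∈ supported ℤ Z ∧ d ≠ 0 ∧
      a = algebraMap _ (FracField X) p / algebraMap _ (FracField X) d := by
  unfold Radd at ha
  induction ha using AddSubgroup.closure_induction with
  | mem x hx =>
    obtain ⟨p, q, hp, hq, hqp, rfl⟩ := hx
    refine ⟨p, q, hp, hq, ?_, rfl⟩
    rintro rfl
    exact hqp 2 (by norm_num) (dvd_zero _)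
  | zero => exact ⟨0, 1, zero_mem _, one_mem _, one_ne_zero, by simp⟩
  | add x y _ _ hx hy =>
    obtain ⟨p, d, hp, hd, hd0, rfl⟩ := hx
    obtain ⟨p', d', hp', hd', hd0', rfl⟩ := hy
    refine ⟨p * d' + d * p', d * d', add_mem (mul_mem hp hd') (mul_mem hd hp'),
      mul_mem hd hd', mul_ne_zero hd0 hd0', ?_⟩
    rw [div_add_div _ _ (by simpa using hd0) (by simpa using hd0')]
    simp only [map_add, map_mul]
  | neg x _ hx =>
    obtain ⟨p, d, hp, hd, hd0, rfl⟩ := hx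
    exact ⟨-p, d, neg_mem hp, hd, hd0, by rw [map_neg, neg_div]⟩

/-- Specialization of a vanishing sum of fractions. -/
lemma aux_spec {A ι : Type*} [CommRing A] [IsDomain A] [DecidableEq ι] (φ : A →+* A)
    (S : Finset ι) (N D : ι → A) (hD : ∀ i ∈ S, φ (D i) ≠ 0)
    (h : ∑ i ∈ S, algebraMap A (FractionRing A) (N i) / algebraMap A (FractionRing A) (D i) = 0) :
    ∑ i ∈ S, algebraMap A (FractionRing A) (φ (N i)) / algebraMap A (FractionRing A) (φ (D i))
      = 0 := by
  have key : ∀ N D : ι → A, (∀ i ∈ S, D i ≠ 0) →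
      (∑ i ∈ S, algebraMap A (FractionRing A) (N i) / algebraMap A (FractionRing A) (D i) = 0 ↔
        ∑ i ∈ S, N i * ∏ j ∈ S.erase i, D j = 0) := by
    intro N D hD
    have hP : algebraMap A (FractionRing A) (∏ j ∈ S, D j) ≠ 0 := by
      simpa [Finset.prod_eq_zero_iff] using hD
    rw [← FaithfulSMul.algebraMap_eq_zero_iff A (FractionRing A), map_sum,
      ← mul_eq_zero_iff_right hP, Finset.sum_mul]
    refine Eq.congr (Finset.sum_congr rfl fun i hi => ?_) rfl
    have hi0 : algebraMap A (FractionRing A) (D i) ≠ 0 := by simpa using hD i hi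
    rw [← Finset.mul_prod_erase S D hi, map_mul, map_mul]
    field_simp
  have hD' : ∀ i ∈ S, D i ≠ 0 := fun i hi h0 => hD i hi (by rw [h0, map_zero])
  rw [key N D hD'] at h
  rw [key _ _ hD]
  have := congrArg φ h
  simpa [map_sum, map_mul, map_prod] using this

open MvPolynomial in
lemma aux_supported {X : Type*} {Z Z' : Set X} (f : MvPolynomial X ℤ →ₐ[ℤ] MvPolynomial X ℤ)
    (hf : ∀ x ∈ Z, f (MvPolynomial.X x) ∈ supported ℤ Z') (p : MvPolynomial X ℤ)
    (hp : p ∈ supported ℤ Z) : f p ∈ supported ℤ Z' := by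
  have : supported ℤ Z ≤ (supported ℤ Z').comap f := by
    rw [supported, Algebra.adjoin_le_iff]
    rintro _ ⟨x, hx, rfl⟩
    exact hf x hx
  exact this hp

open MvPolynomial in
lemma aux_fix {X : Type*} {Z : Set X} (f : MvPolynomial X ℤ →ₐ[ℤ] MvPolynomial X ℤ)
    (hf : ∀ x ∈ Z, f (MvPolynomial.X x) = MvPolynomial.X x) (p : MvPolynomial X ℤ)
    (hp : p ∈ supported ℤ Z) : f p = p := by
  have : supported ℤ Z ≤ AlgHom.equalizer f (AlgHom.id ℤ _) := by
    rw [supported, Algebra.adjoin_le_iff]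
    rintro _ ⟨x, hx, rfl⟩
    exact hf x hx
  exact this hp

/-- Substituting integers for the variables `x₁(q)`. -/
noncomputable def specHom (Y : Type*) (n : ℕ) (c : Fin n → ℤ) :
    MvPolynomial (Var Y n) ℤ →ₐ[ℤ] MvPolynomial (Var Y n) ℤ :=
  MvPolynomial.aeval (Sum.elim (fun y => MvPolynomial.X (Sum.inl y))
    (Sum.elim (fun q => MvPolynomial.X (Sum.inr (Sum.inl q))) (fun q => MvPolynomial.C (c q))))

open MvPolynomial in
lemma aux_exists_spec {Y : Type*} {n : ℕ} (P : MvPolynomial (Var Y n) ℤ) (hP : P ≠ 0) :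
    ∃ c : Fin n → ℤ, specHom Y n c P ≠ 0 := by
  have : ∃ z : Var Y n → ℤ, eval z P ≠ 0 := by
    by_contra! h
    exact hP (MvPolynomial.funext fun z => by rw [h z, map_zero])
  obtain ⟨z, hz⟩ := this
  refine ⟨fun q => z (Sum.inr (Sum.inr q)), fun h => hz ?_⟩
  have h2 : ((aeval z : MvPolynomial (Var Y n) ℤ →ₐ[ℤ] ℤ).comp
      (specHom Y n fun q => z (Sum.inr (Sum.inr q)))) = aeval z := by
    apply MvPolynomial.algHom_ext
    rintro (y | q | q) <;> simp [specHom]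
  have h3 := congrArg (fun f => f P) h2
  simp only [AlgHom.comp_apply, h, map_zero] at h3
  rw [← MvPolynomial.coe_aeval_eq_eval]
  exact h3.symm

open MvPolynomial in
lemma aux_swapAut {Y : Type*} {n : ℕ} (u : Finset (Fin n)) (p : MvPolynomial (Var Y n) ℤ) :
    swapAut Y n u (algebraMap _ _ p) = algebraMap _ _ (rename (swapFun u) p) := by
  unfold swapAut
  rw [IsFractionRing.ringEquivOfRingEquiv_algebraMap]
  rfl

open MvPolynomial in
lemma aux_main {Y : Type*} {n : ℕ} (a : FracField (Var Y n))
    (ha : a ∈ Radd (Var Y n)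
      (Set.range (fun q : Fin n => (Sum.inr (Sum.inl q) : Var Y n)) ∪
        Set.range (Sum.inl : Y → Var Y n)))
    (hb : ∑ u : Finset (Fin n), ((-1 : ℤ) ^ u.card) • swapAut Y n u a = 0) :
    ∃ m : ℤ, m ≠ 0 ∧ m • a ∈ (⨆ ℓ : Fin n, Radd (Var Y n)
          ((Set.range (fun q : Fin n => (Sum.inr (Sum.inl q) : Var Y n)) \
              {Sum.inr (Sum.inl ℓ)}) ∪ Set.range (Sum.inl : Y → Var Y n))) := by
  obtain ⟨p, d, hp, hd, hd0, rfl⟩ := aux_frac a ha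
  have hinj : ∀ u : Finset (Fin n), Function.Injective (swapFun (Y := Y) u) :=
    fun u => (swapFun_involutive u).injective
  have hren : ∀ u : Finset (Fin n), rename (swapFun u) d ≠ 0 := fun u h =>
    hd0 (rename_injective _ (hinj u) (by rw [h, map_zero]))
  obtain ⟨c, hc⟩ := aux_exists_spec (∏ u : Finset (Fin n), rename (swapFun u) d)
    (Finset.prod_ne_zero_iff.mpr fun u _ => hren u)
  rw [map_prod, Finset.prod_ne_zero_iff] at hc
  simp only [map_div₀, aux_swapAut] at hb
  set F : Finset (Fin n) → FracField (Var Y n) := fun u =>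
    algebraMap _ (FracField (Var Y n)) (specHom Y n c (rename (swapFun u) p)) /
    algebraMap _ (FracField (Var Y n)) (specHom Y n c (rename (swapFun u) d)) with hF
  have hs : ∑ u : Finset (Fin n), ((-1 : ℤ) ^ u.card) • F u = 0 := by
    have := aux_spec (specHom Y n c).toRingHom Finset.univ
      (fun u : Finset (Fin n) => ((-1 : ℤ) ^ u.card) • rename (swapFun u) p)
      (fun u : Finset (Fin n) => rename (swapFun u) d) hc
      (by rw [← hb]
          refine Finset.sum_congr rfl fun u _ => ?_
          rw [map_zsmul, smul_div_assoc])
    rw [← this]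
    refine Finset.sum_congr rfl fun u _ => ?_
    rw [map_zsmul, map_zsmul, smul_div_assoc]
    rfl
  -- the terms with nonempty `u`
  have hne : ∀ u : Finset (Fin n), ∃ m : ℤ, m ≠ 0 ∧ (u ≠ ∅ → m • F u ∈
      (⨆ ℓ : Fin n, Radd (Var Y n)
          ((Set.range (fun q : Fin n => (Sum.inr (Sum.inl q) : Var Y n)) \
              {Sum.inr (Sum.inl ℓ)}) ∪ Set.range (Sum.inl : Y → Var Y n)))) := by
    intro u
    by_cases hu : u = ∅
    · exact ⟨1, one_ne_zero, fun h => absurd hu h⟩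
    obtain ⟨ℓ, hℓ⟩ := Finset.nonempty_iff_ne_empty.mpr hu
    have hsup := aux_supported (Z' := (Set.range
        (fun q : Fin n => (Sum.inr (Sum.inl q) : Var Y n)) \
          {Sum.inr (Sum.inl ℓ)}) ∪ Set.range (Sum.inl : Y → Var Y n))
        (Z := (Set.range (fun q : Fin n => (Sum.inr (Sum.inl q) : Var Y n)) ∪
        Set.range (Sum.inl : Y → Var Y n)))
        ((specHom Y n c).comp (rename (swapFun u))) (by
          rintro _ (⟨q, rfl⟩ | ⟨y, rfl⟩)
          · by_cases hq : q ∈ u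
            · simp only [AlgHom.comp_apply, rename_X, swapFun, hq, if_true, specHom, aeval_X,
                Sum.elim_inr]
              exact Subalgebra.algebraMap_mem _ (c q)
            · simp only [AlgHom.comp_apply, rename_X, swapFun, hq, if_false, specHom, aeval_X,
                Sum.elim_inr, Sum.elim_inl]
              rw [X_mem_supported]
              refine Or.inl ⟨⟨q, rfl⟩, ?_⟩
              rintro h
              have : q = ℓ := by simpa using h
              exact hq (this ▸ hℓ)
          · simp only [AlgHom.comp_apply, rename_X, swapFun, specHom, aeval_X, Sum.elim_inl]
            rw [X_mem_supported]
            exact Or.inr ⟨y, rfl⟩)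
    obtain ⟨m, hm, hmem⟩ := aux_mul_mem _ _ (hsup p hp) (hsup d hd) (hc u (Finset.mem_univ _))
    exact ⟨m, hm, fun _ => AddSubgroup.mem_iSup_of_mem ℓ hmem⟩
  choose m hm hmem using hne
  have hfix := aux_fix (Z := (Set.range (fun q : Fin n => (Sum.inr (Sum.inl q) : Var Y n)) ∪
        Set.range (Sum.inl : Y → Var Y n)))
        ((specHom Y n c).comp (rename (swapFun ∅))) (by
          rintro _ (⟨q, rfl⟩ | ⟨y, rfl⟩) <;> simp [swapFun, specHom])
  have hF0 : F ∅ = algebraMap _ (FracField (Var Y n)) p / algebraMap _ (FracField (Var Y n)) d := by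
    have h1 := hfix p hp
    have h2 := hfix d hd
    simp only [AlgHom.comp_apply] at h1 h2
    simp only [hF, h1, h2]
  refine ⟨∏ u, m u, Finset.prod_ne_zero_iff.mpr fun u _ => hm u, ?_⟩
  rw [← hF0]
  rw [← Finset.add_sum_erase _ _ (Finset.mem_univ (∅ : Finset (Fin n)))] at hs
  simp only [Finset.card_empty, pow_zero, one_smul] at hs
  rw [eq_neg_of_add_eq_zero_left hs, zsmul_eq_mul, mul_neg, Finset.mul_sum]
  refine neg_mem (sum_mem fun u hu => ?_)
  have hu' := zsmul_mem (zsmul_mem (hmem u (Finset.ne_of_mem_erase hu))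
    (∏ v ∈ Finset.univ.erase u, m v)) ((-1 : ℤ) ^ u.card)
  convert hu' using 1
  rw [← Finset.prod_erase_mul _ _ (Finset.mem_univ u)]
  simp only [zsmul_eq_mul, Int.cast_mul]
  ring

/-- Let `Y` be countable, `W = {x(1),…,x(n)}`, `V = {x₁(1),…,x₁(n)}`,
`G = R⁺_{W ∪ Y}`, `I = Σ_i R⁺_{W(i) ∪ Y}`.  If `a 1 + I, …, a k + I` are
`ℤ`-linearly independent in `G / I`, then the elements
`b i = Σ_{u ⊆ {1,…,n}} (−1)^{|u|} h_u (a i)` are linearly independent over `ℚ`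
in `ℚ(Y ∪ W ∪ V)`. -/
theorem alternating_sums_linearIndependent {Y : Type*} [Countable Y] {n : ℕ}
    (k : ℕ) (a : Fin k → FracField (Var Y n))
    (haG : ∀ i, a i ∈ Radd (Var Y n)
      (Set.range (fun q : Fin n => (Sum.inr (Sum.inl q) : Var Y n)) ∪
        Set.range (Sum.inl : Y → Var Y n)))
    (hind : ∀ q : Fin k → ℤ,
      (∑ i, q i • a i) ∈
        (⨆ ℓ : Fin n, Radd (Var Y n)
          ((Set.range (fun q : Fin n => (Sum.inr (Sum.inl q) : Var Y n)) \
              {Sum.inr (Sum.inl ℓ)}) ∪ Set.range (Sum.inl : Y → Var Y n))) →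
      ∀ i, q i = 0) :
    LinearIndependent ℚ
      (fun i : Fin k =>
        ∑ u : Finset (Fin n), ((-1 : ℤ) ^ u.card) • swapAut Y n u (a i)) := by
  rw [← LinearIndependent.iff_fractionRing ℤ ℚ, Fintype.linearIndependent_iff]
  intro g hg
  have hsum : ∑ u : Finset (Fin n), ((-1 : ℤ) ^ u.card) • swapAut Y n u (∑ i, g i • a i) = 0 := by
    rw [← hg]
    simp only [zsmul_eq_mul, map_sum, map_mul, map_intCast, Finset.mul_sum]
    rw [Finset.sum_comm]
    exact Finset.sum_congr rfl fun i _ => Finset.sum_congr rfl fun u _ => mul_left_comm _ _ _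
  obtain ⟨m, hm, hmem⟩ := aux_main _ (sum_mem fun i _ => zsmul_mem (haG i) _) hsum
  have hmem' : m • ∑ i, g i • a i = ∑ i, (m * g i) • a i := by
    simp only [zsmul_eq_mul, Finset.mul_sum, Int.cast_mul, mul_assoc]
  rw [hmem'] at hmem
  intro i
  exact (mul_eq_zero.mp (hind (fun i => m * g i) hmem i)).resolve_left hm
end
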